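/- arXiv:2003.14379 — 5 statements merged into one kernel-verified Lean document; each statement's English description precedes it below -/
import Mathlib

section
/- Let A ⊆ B be an extension of commutative integral domains such that B is integral over A and A is integrally closed. Let q be a prime ideal of B and let p = q ∩ A. Assume that A is Noetherian, that B is finitely generated as an A-module, and that the localization B_p := (A∖p)^{-1}B is flat over the local ring A_p. Then κ(q) is a finite extension of κ(p) and [κ(q) : κ(p)] ≤ [K(B) : K(A)]. -/
noncomputable section

open Ideal

universe u v

/-- The field embedding `K(A) →+* K(B)` between fraction fields induced by an injective ring
homomorphism between integral domains. -/
def RingHom.fracMap {A : Type u} {B : Type v} [CommRing A] [IsDomain A] [CommRing B]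
    [IsDomain B] (f : A →+* B) (hf : Function.Injective f) :
    FractionRing A →+* FractionRing B :=
  IsFractionRing.lift (g := (algebraMap B (FractionRing B)).comp f)
    ((IsFractionRing.injective B (FractionRing B)).comp hf)

/-- `[K(B) : K(A)]` as a cardinal, for an injective ring hom `f : A →+* B` of domains. -/
def fracRank {A : Type u} {B : Type v} [CommRing A] [IsDomain A] [CommRing B] [IsDomain B]
    (f : A →+* B) (hf : Function.Injective f) : Cardinal.{v} :=
  letI := (f.fracMap hf).toAlgebra
  Module.rank (FractionRing A) (FractionRing B)

/-- `[K(B) : K(A)]` as a natural number (zero if infinite). -/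
def fracFinrank {A : Type u} {B : Type v} [CommRing A] [IsDomain A] [CommRing B] [IsDomain B]
    (f : A →+* B) (hf : Function.Injective f) : ℕ :=
  letI := (f.fracMap hf).toAlgebra
  Module.finrank (FractionRing A) (FractionRing B)

/-- `K(B)/K(A)` is a finite extension. -/
def FracFinite {A : Type u} {B : Type v} [CommRing A] [IsDomain A] [CommRing B] [IsDomain B]
    (f : A →+* B) (hf : Function.Injective f) : Prop :=
  letI := (f.fracMap hf).toAlgebra
  Module.Finite (FractionRing A) (FractionRing B)

/-- The canonical embedding of residue fields `κ(p) →+* κ(q)` for a prime `q` of `B` lying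
over `p = q ∩ A`, where `κ(q)` is the fraction field of `B ⧸ q`. -/
def residueMap (A : Type u) {B : Type v} [CommRing A] [CommRing B] [Algebra A B]
    (q : Ideal B) (hq : q.IsPrime) :
    FractionRing (A ⧸ q.comap (algebraMap A B)) →+* FractionRing (B ⧸ q) :=
  haveI := hq
  (Ideal.quotientMap q (algebraMap A B) le_rfl).fracMap Ideal.quotientMap_injective

/-- The field-extension structure `κ(q)/κ(p)`. -/
def residueAlgebra (A : Type u) {B : Type v} [CommRing A] [CommRing B] [Algebra A B]
    (q : Ideal B) (hq : q.IsPrime) :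
    Algebra (FractionRing (A ⧸ q.comap (algebraMap A B))) (FractionRing (B ⧸ q)) :=
  (residueMap A q hq).toAlgebra

/-- The residue degree `[κ(q) : κ(p)]` as a cardinal. -/
def residueRank (A : Type u) {B : Type v} [CommRing A] [CommRing B] [Algebra A B]
    (q : Ideal B) (hq : q.IsPrime) : Cardinal.{v} :=
  haveI := hq
  letI := residueAlgebra A q hq
  Module.rank (FractionRing (A ⧸ q.comap (algebraMap A B))) (FractionRing (B ⧸ q))

/-- The residue degree `[κ(q) : κ(p)]` as a natural number (zero if infinite). -/
def residueFinrank (A : Type u) {B : Type v} [CommRing A] [CommRing B] [Algebra A B]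
    (q : Ideal B) (hq : q.IsPrime) : ℕ :=
  haveI := hq
  letI := residueAlgebra A q hq
  Module.finrank (FractionRing (A ⧸ q.comap (algebraMap A B))) (FractionRing (B ⧸ q))

/-- `κ(q)/κ(p)` is a finite extension. -/
def ResidueFinite (A : Type u) {B : Type v} [CommRing A] [CommRing B] [Algebra A B]
    (q : Ideal B) (hq : q.IsPrime) : Prop :=
  haveI := hq
  letI := residueAlgebra A q hq
  Module.Finite (FractionRing (A ⧸ q.comap (algebraMap A B))) (FractionRing (B ⧸ q))

/-- A commutative ring is a regular local ring if it is a Noetherian local ring in which the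
minimal number of generators of the maximal ideal equals the Krull dimension. -/
def IsRegularLocal (R : Type u) [CommRing R] : Prop :=
  IsNoetherianRing R ∧ ∃ h : IsLocalRing R,
    (↑(sInf {n : ℕ | ∃ s : Finset R, s.card = n ∧
        Ideal.span (s : Set R) = @IsLocalRing.maximalIdeal R _ h}) : WithBot ℕ∞) = ringKrullDim R

/-- A finite flat localization bounds the rank of any field extension generated by `B`. -/
lemma rank_le_of_flat_aux
    (A : Type u) (B : Type v) [CommRing A] [IsDomain A] [CommRing B] [IsDomain B]
    [Algebra A B] [Module.Finite A B] (p : Ideal A) [p.IsPrime]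
    [Module.Flat (Localization.AtPrime p) (LocalizedModule p.primeCompl B)]
    (K : Type u) (L : Type v) [Field K] [Field L] [Algebra A K] [Algebra B L] [Algebra K L]
    (hcomm : ∀ a : A, algebraMap K L (algebraMap A K a) = algebraMap B L (algebraMap A B a))
    (hK : ∀ s : A, s ∉ p → algebraMap A K s ≠ 0)
    (hspan : Submodule.span K (Set.range (algebraMap B L)) = ⊤) :
    Module.Finite K L ∧ Module.rank K L ≤ Module.rank A B := by
  let R := Localization.AtPrime p
  let M := LocalizedModule p.primeCompl B
  haveI : Module.Finite R M := inferInstance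
  haveI : Module.Free R M := Module.free_of_flat_of_isLocalRing
  let ι := Module.Free.ChooseBasisIndex R M
  let b : Module.Basis ι R M := Module.Free.chooseBasis R M
  have hcard : Cardinal.lift.{max u v} (Cardinal.mk ι) = Cardinal.lift.{max u v} (Module.rank A B) := by
    have h1 := b.mk_eq_rank''
    have h2 : Module.rank R M = Module.rank A M :=
      IsLocalization.rank_eq R p.primeCompl p.primeCompl_le_nonZeroDivisors
    have h3 := IsLocalizedModule.lift_rank_eq p.primeCompl
      (LocalizedModule.mkLinearMap p.primeCompl B) p.primeCompl_le_nonZeroDivisors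
    rw [← h2, ← h1] at h3
    simpa using h3
  have hc : ∀ i, ∃ c : B, ∃ s : p.primeCompl, b i = LocalizedModule.mk c s := fun i => by
    induction h : b i using LocalizedModule.induction_on with
    | _ m s => exact ⟨m, s, rfl⟩
  choose c s hcs using hc
  have key : Submodule.span K (Set.range fun i => algebraMap B L (c i)) = ⊤ := by
    rw [eq_top_iff, ← hspan, Submodule.span_le]
    rintro _ ⟨x, rfl⟩
    set V := Submodule.span K (Set.range fun i => algebraMap B L (c i)) with hV
    have hbm : ∀ m : M, ∃ (y : B) (t : p.primeCompl),
        m = LocalizedModule.mk y t ∧ algebraMap B L y ∈ V := by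
      intro m
      have hm : m ∈ Submodule.span R (Set.range b) := by rw [b.span_eq]; trivial
      induction hm using Submodule.span_induction with
      | mem m hm =>
        obtain ⟨i, rfl⟩ := hm
        exact ⟨c i, s i, hcs i, Submodule.subset_span ⟨i, rfl⟩⟩
      | zero => exact ⟨0, 1, (LocalizedModule.zero_mk 1).symm, by simp⟩
      | add m n _ _ hm hn =>
        obtain ⟨y, t, rfl, hy⟩ := hm
        obtain ⟨z, w, rfl, hz⟩ := hn
        refine ⟨w • y + t • z, t * w, LocalizedModule.mk_add_mk, ?_⟩
        have e : algebraMap B L (w • y + t • z) = algebraMap A K w • algebraMap B L y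
            + algebraMap A K t • algebraMap B L z := by
          simp [Submonoid.smul_def, Algebra.smul_def, hcomm]
        rw [e]
        exact V.add_mem (V.smul_mem _ hy) (V.smul_mem _ hz)
      | smul r m _ hm =>
        obtain ⟨y, t, rfl, hy⟩ := hm
        obtain ⟨⟨a, w⟩, rfl⟩ := IsLocalization.mk'_surjective p.primeCompl r
        refine ⟨a • y, w * t, ?_, ?_⟩
        · rw [← Localization.mk_eq_mk', LocalizedModule.mk_smul_mk]
        · have e : algebraMap B L (a • y) = algebraMap A K a • algebraMap B L y := by
            simp [Algebra.smul_def, hcomm]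
          rw [e]
          exact V.smul_mem _ hy
    obtain ⟨y, t, hm, hy⟩ := hbm (LocalizedModule.mk x 1)
    rw [LocalizedModule.mk_eq] at hm
    obtain ⟨u, hu⟩ := hm
    have e := congrArg (algebraMap B L) hu
    simp only [Submonoid.smul_def, Algebra.smul_def, map_mul, ← hcomm, OneMemClass.coe_one,
      map_one, one_mul] at e
    have hu0 : algebraMap K L (algebraMap A K u) ≠ 0 := by
      simpa using hK u u.2
    have e2 := mul_left_cancel₀ hu0 e
    have h : algebraMap A K t • algebraMap B L x ∈ V := by
      rw [Algebra.smul_def, e2]; exact hy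
    exact (V.smul_mem_iff (hK t t.2)).1 h
  refine ⟨⟨(Submodule.fg_def).2 ⟨_, Set.finite_range _, key⟩⟩, ?_⟩
  have h1 := rank_span_le (R := K) (Set.range fun i => algebraMap B L (c i))
  rw [key, rank_top] at h1
  have h2 := Cardinal.mk_range_le_lift (f := fun i => algebraMap B L (c i))
  rw [← Cardinal.lift_le.{max u v}]
  refine (Cardinal.lift_le.2 h1).trans ?_
  rw [← hcard]
  simpa using h2

/-- Let `A ⊆ B` be an extension of integral domains with `B` integral over `A`
and `A` integrally closed.  Let `q` be a prime of `B` and `p = q ∩ A`.  If `A` is Noetherian,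
`B` is a finite `A`-module, and the localization `B_p = (A∖p)⁻¹B` is flat over `A_p`, then
`κ(q)/κ(p)` is finite and `[κ(q) : κ(p)] ≤ [K(B) : K(A)]`. -/
theorem residue_degree_le_of_flat
    (A : Type u) (B : Type v) [CommRing A] [IsDomain A] [CommRing B] [IsDomain B]
    [Algebra A B] (hAB : Function.Injective (algebraMap A B))
    [Algebra.IsIntegral A B] [IsIntegrallyClosed A]
    [IsNoetherianRing A] [Module.Finite A B]
    (q : Ideal B) (hq : q.IsPrime)
    (hflat : haveI := hq;
      Module.Flat (Localization.AtPrime (q.comap (algebraMap A B)))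
        (LocalizedModule (q.comap (algebraMap A B)).primeCompl B)) :
    ResidueFinite A q hq ∧
      residueRank A q hq ≤ fracRank (algebraMap A B) hAB := by
  haveI := hq
  let p := q.comap (algebraMap A B)
  haveI : Module.Flat (Localization.AtPrime p) (LocalizedModule p.primeCompl B) := hflat
  haveI : FaithfulSMul A B := (faithfulSMul_iff_algebraMap_injective A B).2 hAB
  have hfrac : fracRank (algebraMap A B) hAB = Module.rank A B := by
    unfold fracRank
    letI := ((algebraMap A B).fracMap hAB).toAlgebra
    haveI : IsScalarTower A (FractionRing A) (FractionRing B) := by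
      refine IsScalarTower.of_algebraMap_eq fun x => ?_
      rw [RingHom.algebraMap_toAlgebra, RingHom.fracMap, IsFractionRing.lift_algebraMap,
        IsScalarTower.algebraMap_apply A B (FractionRing B)]
      rfl
    exact Algebra.IsAlgebraic.rank_of_isFractionRing A (FractionRing A) B (FractionRing B)
  rw [hfrac]
  letI alg := residueAlgebra A q hq
  have hmap : ∀ x : A ⧸ p, algebraMap (FractionRing (A ⧸ p)) (FractionRing (B ⧸ q))
      (algebraMap (A ⧸ p) _ x) = algebraMap (B ⧸ q) _
        (Ideal.quotientMap q (algebraMap A B) le_rfl x) := fun x =>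
    IsFractionRing.lift_algebraMap
      (g := (algebraMap (B ⧸ q) (FractionRing (B ⧸ q))).comp
        (Ideal.quotientMap q (algebraMap A B) le_rfl))
      ((IsFractionRing.injective (B ⧸ q) (FractionRing (B ⧸ q))).comp
        Ideal.quotientMap_injective) x
  refine rank_le_of_flat_aux A B p (FractionRing (A ⧸ p)) (FractionRing (B ⧸ q)) ?_ ?_ ?_
  · intro a
    exact hmap (Ideal.Quotient.mk p a)
  · intro s hs h
    rw [IsScalarTower.algebraMap_apply A (A ⧸ p) (FractionRing (A ⧸ p)),
      map_eq_zero_iff _ (IsFractionRing.injective (A ⧸ p) (FractionRing (A ⧸ p)))] at h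
    exact hs (Ideal.Quotient.eq_zero_iff_mem.1 h)
  · rw [eq_top_iff]
    rintro x -
    letI : Algebra (A ⧸ p) (B ⧸ q) := (Ideal.quotientMap q (algebraMap A B) le_rfl).toAlgebra
    haveI : IsScalarTower A (A ⧸ p) (B ⧸ q) := IsScalarTower.of_algebraMap_eq fun x => rfl
    haveI : Algebra.IsIntegral A (B ⧸ q) := inferInstance
    haveI : Algebra.IsIntegral (A ⧸ p) (B ⧸ q) := Algebra.IsIntegral.tower_top A
    haveI : FaithfulSMul (A ⧸ p) (B ⧸ q) :=
      (faithfulSMul_iff_algebraMap_injective _ _).2 Ideal.quotientMap_injective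
    obtain ⟨⟨d, ⟨_, c, hc, rfl⟩⟩, hx⟩ := IsLocalization.surj
      (Algebra.algebraMapSubmonoid (B ⧸ q) (nonZeroDivisors (A ⧸ p))) x
    have hc0 : algebraMap (A ⧸ p) (FractionRing (A ⧸ p)) c ≠ 0 := by
      rw [Ne, map_eq_zero_iff _ (IsFractionRing.injective _ _)]
      exact nonZeroDivisors.ne_zero hc
    obtain ⟨d, rfl⟩ := Ideal.Quotient.mk_surjective d
    rw [← Submodule.smul_mem_iff _ hc0, Algebra.smul_def, hmap, mul_comm]
    refine Submodule.subset_span ⟨d, ?_⟩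
    exact hx.symm

end
end

section
/- Let A ⊆ B be an extension of commutative integral domains such that B is integral over A and A is integrally closed. Let q be a prime ideal of B and let p = q ∩ A. Assume that the localization A_p is a regular local ring and that the field extension K(B)/K(A) is finite. Then κ(q) is a finite extension of κ(p) and [κ(q) : κ(p)] ≤ [K(B) : K(A)]. -/
noncomputable section

open Ideal

universe u v

/-- A Noetherian local ring whose maximal ideal is generated by at most `n` elements and whose
dimension is at least `n`. -/
def RegN (n : ℕ) (R : Type u) [CommRing R] : Prop :=
  IsNoetherianRing R ∧ ∃ _ : IsLocalRing R,
    (∃ s : Finset R, s.card ≤ n ∧ Ideal.span (s : Set R) = IsLocalRing.maximalIdeal R) ∧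
      (n : WithBot ℕ∞) ≤ ringKrullDim R

lemma regN_quotient {R : Type u} [CommRing R] [IsNoetherianRing R] [IsLocalRing R] (n : ℕ)
    (s : Finset R) (hs : s.card ≤ n + 1) (hm : Ideal.span (s : Set R) = IsLocalRing.maximalIdeal R)
    (hd : ((n + 1 : ℕ) : WithBot ℕ∞) ≤ ringKrullDim R) (x y : R)
    (hx : x ∈ IsLocalRing.maximalIdeal R) (hy : y ∈ s)
    (hyx : y ∈ Ideal.span (insert x ((s : Set R) \ {y}))) :
    RegN n (R ⧸ Ideal.span {x}) := by
  classical
  have hne : Ideal.span {x} ≠ ⊤ := by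
    intro h
    have : Ideal.span {x} ≤ IsLocalRing.maximalIdeal R := by
      rw [Ideal.span_le]; simpa using hx
    rw [h, top_le_iff] at this
    exact (IsLocalRing.maximalIdeal.isMaximal R).ne_top this
  have : Nontrivial (R ⧸ Ideal.span {x}) := Ideal.Quotient.nontrivial_iff.mpr hne
  have : IsLocalRing (R ⧸ Ideal.span {x}) :=
    IsLocalRing.of_surjective' (Ideal.Quotient.mk _) Ideal.Quotient.mk_surjective
  refine ⟨inferInstance, inferInstance, ⟨(s.erase y).image (Ideal.Quotient.mk _), ?_, ?_⟩, ?_⟩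
  · refine Finset.card_image_le.trans ?_
    rw [Finset.card_erase_of_mem hy]; omega
  · have hmap : (IsLocalRing.maximalIdeal R).map (Ideal.Quotient.mk (Ideal.span {x})) =
        IsLocalRing.maximalIdeal (R ⧸ Ideal.span {x}) := by
      rcases Ideal.map_eq_top_or_isMaximal_of_surjective (Ideal.Quotient.mk (Ideal.span {x}))
        Ideal.Quotient.mk_surjective (IsLocalRing.maximalIdeal.isMaximal R) with h | h
      · exfalso
        have h2 := Ideal.comap_map_of_surjective (Ideal.Quotient.mk (Ideal.span {x}))
          Ideal.Quotient.mk_surjective (IsLocalRing.maximalIdeal R)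
        rw [h, Ideal.comap_top, ← RingHom.ker_eq_comap_bot, Ideal.mk_ker] at h2
        have : Ideal.span {x} ≤ IsLocalRing.maximalIdeal R := by
          rw [Ideal.span_le]; simpa using hx
        rw [sup_eq_left.mpr this] at h2
        exact (IsLocalRing.maximalIdeal.isMaximal R).ne_top h2.symm
      · exact IsLocalRing.eq_maximalIdeal h
    rw [← hmap, ← hm, Finset.coe_image, ← Ideal.map_span]
    apply le_antisymm
    · exact Ideal.map_mono (Ideal.span_mono (by simp))
    · have h1 : Ideal.span (s : Set R) ≤ Ideal.span (insert x ((s : Set R) \ {y})) := by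
        rw [Ideal.span_le]
        intro z hz
        by_cases hzy : z = y
        · rw [hzy]; exact hyx
        · exact Ideal.subset_span (Or.inr ⟨hz, hzy⟩)
      refine (Ideal.map_mono h1).trans ?_
      rw [Ideal.map_span, Ideal.span_le, Finset.coe_erase]
      rintro _ ⟨z, hz, rfl⟩
      rcases hz with rfl | hz
      · have : Ideal.Quotient.mk (Ideal.span {z}) z = 0 :=
          Ideal.Quotient.eq_zero_iff_mem.mpr (Ideal.mem_span_singleton_self z)
        rw [this]; exact Ideal.zero_mem _
      · exact Ideal.mem_map_of_mem _ (Ideal.subset_span hz)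
  · have h := ringKrullDim_le_ringKrullDim_quotient_add_encard (R := R) {x} (by
      rw [IsLocalRing.ringJacobson_eq_maximalIdeal]; simpa using hx)
    have h := hd.trans h
    rw [Set.encard_singleton] at h
    push_cast at h
    exact (ENat.WithBot.add_le_add_one_right_iff).mp h

lemma isDomain_of_regN (n : ℕ) : ∀ (R : Type u) [CommRing R], RegN n R → IsDomain R := by
  induction n with
  | zero =>
    rintro R _ ⟨_, _, ⟨s, hs, hm⟩, hd⟩
    have : s = ∅ := by simpa using hs
    subst this
    have hb : IsLocalRing.maximalIdeal R = ⊥ := by rw [← hm]; simp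
    exact (IsLocalRing.isField_iff_maximalIdeal_eq.mpr hb).isDomain
  | succ n ih =>
    rintro R _ ⟨_, _, ⟨s, hs, hm⟩, hd⟩
    classical
    set m := IsLocalRing.maximalIdeal R with hmdef
    have hnmin : m ∉ minimalPrimes R := by
      intro h
      have h0 := Ideal.height_eq_zero_iff.mpr h
      rw [← IsLocalRing.maximalIdeal_height_eq_ringKrullDim, h0] at hd
      have : ((n + 1 : ℕ) : ℕ∞) ≤ 0 := by exact_mod_cast hd
      simp at this
    have hmb : m ≠ ⊥ := by
      intro h
      apply hnmin
      refine ⟨⟨inferInstance, bot_le⟩, fun J _ _ => ?_⟩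
      rw [h]; exact bot_le
    have hm2 : ¬ m ≤ m * m := by
      intro h
      exact hmb (Submodule.eq_bot_of_le_smul_of_le_jacobson_bot m m
        (IsNoetherian.noetherian m) h (IsLocalRing.maximalIdeal_le_jacobson _))
    obtain ⟨x, hxm, hx2, hxp⟩ : ∃ x ∈ m, x ∉ m * m ∧ ∀ P ∈ minimalPrimes R, x ∉ P := by
      by_contra! hcon
      have hfin := minimalPrimes.finite_of_isNoetherianRing R
      have hsub : (m : Set R) ⊆ ⋃ i ∈ (insert (m * m) (minimalPrimes R)), ((id i : Ideal R) : Set R) := by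
        intro x hx
        by_cases h2 : x ∈ m * m
        · exact Set.mem_biUnion (Set.mem_insert _ _) h2
        · obtain ⟨P, hP, hxP⟩ := hcon x hx h2
          exact Set.mem_biUnion (Set.mem_insert_of_mem _ hP) hxP
      rw [Ideal.subset_union_prime_finite (hfin.insert _) (m * m) (m * m)] at hsub
      · obtain ⟨P, hP, hle⟩ := hsub
        rcases hP with rfl | hP
        · exact hm2 hle
        · have hPp : P.IsPrime := hP.1.1
          have : P = m := le_antisymm (IsLocalRing.le_maximalIdeal hPp.ne_top) hle
          exact hnmin (this ▸ hP)
      · rintro P hP h1 -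
        rcases hP with rfl | hP
        · exact absurd rfl h1
        · exact hP.1.1
    have hxs : x ∈ Ideal.span (s : Set R) := hm ▸ hxm
    obtain ⟨c, -, hc⟩ := Submodule.mem_span_finset.mp hxs
    obtain ⟨y, hy, hcy⟩ : ∃ y ∈ s, c y ∉ m := by
      by_contra! hcon
      apply hx2
      rw [← hc]
      refine Ideal.sum_mem _ fun y hy => Ideal.mul_mem_mul (hcon y hy) ?_
      rw [← hm]; exact Ideal.subset_span hy
    have hu : IsUnit (c y) := by simpa [hmdef] using hcy
    have hreg : RegN n (R ⧸ Ideal.span {x}) := by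
      refine regN_quotient n s hs hm hd x y hxm hy ?_
      obtain ⟨u, hu⟩ := hu
      have : y = (↑u⁻¹ : R) * (x - ∑ z ∈ s.erase y, c z • z) := by
        rw [← hc, ← Finset.add_sum_erase s _ hy, add_sub_cancel_right, ← hu, smul_eq_mul,
          Units.inv_mul_cancel_left]
      rw [this]
      refine Ideal.mul_mem_left _ _ (Ideal.sub_mem _ (Ideal.subset_span (Set.mem_insert _ _)) ?_)
      refine Ideal.sum_mem _ fun z hz => Ideal.mul_mem_left _ _ (Ideal.subset_span ?_)
      rw [Finset.mem_erase] at hz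
      rw [← this]
      exact Or.inr ⟨hz.2, hz.1⟩
    have hdom := ih _ hreg
    have hprime : (Ideal.span {x}).IsPrime := (Ideal.Quotient.isDomain_iff_prime _).mp hdom
    obtain ⟨P, hP, hPx⟩ := Ideal.exists_minimalPrimes_le (bot_le (a := Ideal.span {x}))
    have hxP : x ∉ P := hxp P hP
    have hPp : P.IsPrime := hP.1.1
    have hP0 : P = ⊥ := by
      refine Submodule.eq_bot_of_le_smul_of_le_jacobson_bot (Ideal.span {x}) P
        (IsNoetherian.noetherian P) ?_ ?_
      · intro z hz
        obtain ⟨w, rfl⟩ := Ideal.mem_span_singleton'.mp (hPx hz)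
        have hw : w ∈ P := (hPp.mem_or_mem hz).resolve_right hxP
        rw [mul_comm]
        exact Ideal.mul_mem_mul (Ideal.mem_span_singleton_self x) hw
      · refine le_trans ?_ (IsLocalRing.maximalIdeal_le_jacobson _)
        rw [Ideal.span_le, Set.singleton_subset_iff]; exact hxm
    rw [hP0] at hPp
    refine @NoZeroDivisors.to_isDomain R _ inferInstance ⟨fun {a b} hab => ?_⟩
    exact hPp.mem_or_mem (show a * b ∈ (⊥ : Ideal R) from hab)

/-- Chains of primes, each generated by one more element than the preceding one. -/
inductive Ch (R : Type u) [CommRing R] : Ideal R → Prop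
  | bot : (⊥ : Ideal R).IsPrime → Ch R ⊥
  | step (P : Ideal R) (x : R) : Ch R P → (P ⊔ Ideal.span {x}).IsPrime → Ch R (P ⊔ Ideal.span {x})

lemma Ch.isPrime {R : Type u} [CommRing R] {P : Ideal R} (h : Ch R P) : P.IsPrime := by
  cases h <;> assumption

lemma Ch.comap {R : Type u} [CommRing R] (x : R) (h0 : (⊥ : Ideal R).IsPrime)
    {J : Ideal (R ⧸ Ideal.span {x})} (h : Ch _ J) :
    Ch R (J.comap (Ideal.Quotient.mk (Ideal.span {x}))) := by
  induction h with
  | bot hb =>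
    have : (Ideal.comap (Ideal.Quotient.mk (Ideal.span {x})) ⊥) = ⊥ ⊔ Ideal.span {x} := by
      rw [← RingHom.ker_eq_comap_bot, Ideal.mk_ker, bot_sup_eq]
    have hp : (Ideal.comap (Ideal.Quotient.mk (Ideal.span {x})) ⊥).IsPrime := Ideal.IsPrime.comap _
    rw [this] at hp ⊢
    exact Ch.step _ _ (Ch.bot h0) hp
  | step P y hP hy ih =>
    obtain ⟨y, rfl⟩ := Ideal.Quotient.mk_surjective y
    have : (P ⊔ Ideal.span {Ideal.Quotient.mk (Ideal.span {x}) y}).comap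
        (Ideal.Quotient.mk (Ideal.span {x})) =
        P.comap (Ideal.Quotient.mk (Ideal.span {x})) ⊔ Ideal.span {y} := by
      have e : P ⊔ Ideal.span {Ideal.Quotient.mk (Ideal.span {x}) y} =
        (P.comap (Ideal.Quotient.mk (Ideal.span {x})) ⊔ Ideal.span {y}).map
          (Ideal.Quotient.mk (Ideal.span {x})) := by
        rw [Ideal.map_sup, Ideal.map_comap_of_surjective _ Ideal.Quotient.mk_surjective,
          Ideal.map_span, Set.image_singleton]
      rw [e, Ideal.comap_map_of_surjective _ Ideal.Quotient.mk_surjective, sup_eq_left]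
      exact le_trans (Ideal.comap_mono bot_le) le_sup_left
    have hp := hy.comap (Ideal.Quotient.mk (Ideal.span {x}))
    rw [this] at hp ⊢
    exact Ch.step _ _ ih hp

lemma ch_of_regN (n : ℕ) : ∀ (R : Type u) [CommRing R] [IsLocalRing R], RegN n R →
    Ch R (IsLocalRing.maximalIdeal R) := by
  induction n with
  | zero =>
    rintro R _ _ ⟨_, _, ⟨s, hs, hm⟩, hd⟩
    have : s = ∅ := by simpa using hs
    subst this
    have hb : IsLocalRing.maximalIdeal R = ⊥ := by rw [← hm]; simp
    have hp : (IsLocalRing.maximalIdeal R).IsPrime := inferInstance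
    rw [hb] at hp ⊢
    exact Ch.bot hp
  | succ n ih =>
    intro R _ _ hR
    have := isDomain_of_regN _ R hR
    obtain ⟨_, _, ⟨s, hs, hm⟩, hd⟩ := hR
    obtain ⟨x, hx⟩ : s.Nonempty := by
      rw [Finset.nonempty_iff_ne_empty]
      rintro rfl
      have hb : IsLocalRing.maximalIdeal R = ⊥ := by rw [← hm]; simp
      rw [ringKrullDim_eq_zero_of_isField (IsLocalRing.isField_iff_maximalIdeal_eq.mpr hb)] at hd
      have : n + 1 ≤ 0 := by exact_mod_cast hd
      omega
    have hxm : x ∈ IsLocalRing.maximalIdeal R := hm ▸ Ideal.subset_span hx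
    have hq := regN_quotient n s hs hm hd x x hxm hx (Ideal.subset_span (Set.mem_insert _ _))
    have : IsLocalRing (R ⧸ Ideal.span {x}) := hq.2.1
    have := (ih _ hq).comap x (Ideal.isPrime_bot)
    convert this
    refine (IsLocalRing.eq_maximalIdeal ?_).symm
    exact Ideal.comap_isMaximal_of_surjective _ Ideal.Quotient.mk_surjective

lemma regN_of_isRegularLocal {R : Type u} [CommRing R] (h : IsRegularLocal R) :
    ∃ n, RegN n R := by
  obtain ⟨hN, hL, hd⟩ := h
  refine ⟨_, hN, hL, ?_, hd.le⟩
  have hne : {n : ℕ | ∃ s : Finset R, s.card = n ∧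
        Ideal.span (s : Set R) = IsLocalRing.maximalIdeal R}.Nonempty := by
    obtain ⟨s, hs⟩ := IsNoetherian.noetherian (IsLocalRing.maximalIdeal R)
    exact ⟨_, s, rfl, hs⟩
  obtain ⟨s, hs, hm⟩ := Nat.sInf_mem hne
  exact ⟨s, hs.le, hm⟩

/-- `a` is divisible by `b` in the localization of `R/P` at `P'`. -/
def RelDvd {R : Type u} [CommRing R] (P P' : Ideal R) (a b : R) : Prop :=
  ∃ t c, t ∉ P' ∧ t * a - b * c ∈ P

lemma relDvd_total {R : Type u} [CommRing R] [IsNoetherianRing R] (P : Ideal R) [P.IsPrime] (x : R)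
    (h : (P ⊔ Ideal.span {x}).IsPrime) (a b : R) :
    RelDvd P (P ⊔ Ideal.span {x}) a b ∨ RelDvd P (P ⊔ Ideal.span {x}) b a := by
  set P' := P ⊔ Ideal.span {x} with hP'
  have h1 : (1 : R) ∉ P' := fun h' => h.ne_top ((Ideal.eq_top_iff_one _).mpr h')
  by_cases ha : a ∈ P
  · exact Or.inl ⟨1, 0, h1, by simpa using ha⟩
  by_cases hb : b ∈ P
  · exact Or.inr ⟨1, 0, h1, by simpa using hb⟩
  by_cases hx : x ∈ P
  · have : P' = P := by
      rw [hP', sup_eq_left, Ideal.span_le]; simpa using hx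
    refine Or.inl ⟨b, a, by rwa [this], ?_⟩
    simp
  have hmem : ∀ r : R, r ∈ P' ↔ Ideal.Quotient.mk P x ∣ Ideal.Quotient.mk P r := by
    intro r
    rw [hP', sup_comm, Submodule.mem_sup]
    constructor
    · rintro ⟨y, hy, z, hz, rfl⟩
      rw [map_add, Ideal.Quotient.eq_zero_iff_mem.mpr hz, add_zero]
      exact map_dvd _ (Ideal.mem_span_singleton.mp hy)
    · rintro ⟨w, hw⟩
      obtain ⟨w, rfl⟩ := Ideal.Quotient.mk_surjective w
      rw [← map_mul, Ideal.Quotient.mk_eq_mk_iff_sub_mem] at hw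
      exact ⟨x * w, Ideal.mul_mem_right _ _ (Ideal.mem_span_singleton_self x), _, hw, by ring⟩
  have hprime : Prime (Ideal.Quotient.mk P x) := by
    refine ⟨fun h' => hx (Ideal.Quotient.eq_zero_iff_mem.mp h'), fun h' => ?_, ?_⟩
    · exact h1 ((hmem 1).mpr h'.dvd)
    · intro r s hrs
      obtain ⟨r, rfl⟩ := Ideal.Quotient.mk_surjective r
      obtain ⟨s, rfl⟩ := Ideal.Quotient.mk_surjective s
      rw [← map_mul, ← hmem] at hrs
      rw [← hmem, ← hmem]
      exact h.mem_or_mem hrs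
  have key : ∀ r : R, r ∉ P → ∃ (k : ℕ) (u : R), u ∉ P' ∧
      Ideal.Quotient.mk P r = Ideal.Quotient.mk P x ^ k * Ideal.Quotient.mk P u := by
    intro r hr
    obtain ⟨k, u, hu, e⟩ := WfDvdMonoid.max_power_factor
      (fun h' => hr (Ideal.Quotient.eq_zero_iff_mem.mp h')) hprime.irreducible
    obtain ⟨u, rfl⟩ := Ideal.Quotient.mk_surjective u
    exact ⟨k, u, fun h' => hu ((hmem u).mp h'), e⟩
  obtain ⟨k, u, hu, ea⟩ := key a ha
  obtain ⟨l, v, hv, eb⟩ := key b hb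
  rcases le_total k l with hkl | hkl
  · right
    refine ⟨u, x ^ (l - k) * v, hu, ?_⟩
    rw [← Ideal.Quotient.mk_eq_mk_iff_sub_mem]
    simp only [map_mul, map_pow, ea, eb]
    rw [← Nat.add_sub_cancel' hkl, pow_add, Nat.add_sub_cancel_left]; ring
  · left
    refine ⟨v, x ^ (k - l) * u, hv, ?_⟩
    rw [← Ideal.Quotient.mk_eq_mk_iff_sub_mem]
    simp only [map_mul, map_pow, ea, eb]
    rw [← Nat.add_sub_cancel' hkl, pow_add, Nat.add_sub_cancel_left]; ring

lemma relDvd_comap {A : Type u} [CommRing A] (p : Ideal A) [p.IsPrime]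
    (P P' : Ideal (Localization.AtPrime p)) [P'.IsPrime] (a b : A)
    (h : RelDvd P P' (algebraMap A _ a) (algebraMap A _ b)) :
    RelDvd (P.comap (algebraMap A _)) (P'.comap (algebraMap A _)) a b := by
  obtain ⟨t, c, ht, hm⟩ := h
  obtain ⟨⟨s, hs⟩, hsi⟩ := IsLocalization.exist_integer_multiples_of_finite p.primeCompl ![t, c]
  obtain ⟨t', ht'⟩ := hsi 0
  obtain ⟨c', hc'⟩ := hsi 1
  simp only [Matrix.cons_val_zero, Matrix.cons_val_one, Algebra.smul_def] at ht' hc'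
  refine ⟨t', c', ?_, ?_⟩
  · rw [Ideal.mem_comap, ht']
    intro h'
    rcases Ideal.IsPrime.mem_or_mem ‹P'.IsPrime› h' with h' | h'
    · exact Ideal.IsPrime.ne_top ‹P'.IsPrime› (Ideal.eq_top_of_isUnit_mem _ h'
        (IsLocalization.map_units (Localization.AtPrime p) (⟨s, hs⟩ : p.primeCompl)))
    · exact ht h'
  · rw [Ideal.mem_comap, map_sub, map_mul, map_mul, ht', hc']
    convert Ideal.mul_mem_left P (algebraMap A _ s) hm using 1
    ring

lemma relDvd_trans {R : Type u} [CommRing R] {P P' : Ideal R} [P'.IsPrime] {a b c : R}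
    (h1 : RelDvd P P' a b) (h2 : RelDvd P P' b c) : RelDvd P P' a c := by
  obtain ⟨t, d, ht, h1⟩ := h1
  obtain ⟨t', d', ht', h2⟩ := h2
  refine ⟨t' * t, d' * d, fun h => ?_, ?_⟩
  · rcases Ideal.IsPrime.mem_or_mem ‹P'.IsPrime› h with h | h
    exacts [ht' h, ht h]
  · convert P.add_mem (P.mul_mem_left t' h1) (P.mul_mem_left d h2) using 1
    ring

lemma exists_relDvd_all {R : Type u} [CommRing R] {P P' : Ideal R} [P'.IsPrime]
    (htot : ∀ a b, RelDvd P P' a b ∨ RelDvd P P' b a) (n : ℕ) (a : Fin (n + 1) → R) :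
    ∃ j, ∀ i, RelDvd P P' (a i) (a j) := by
  induction n with
  | zero =>
    refine ⟨0, fun i => ?_⟩
    rw [Fin.fin_one_eq_zero i]
    exact (htot _ _).elim id id
  | succ n ih =>
    obtain ⟨j, hj⟩ := ih (fun i => a i.succ)
    rcases htot (a 0) (a j.succ) with h | h
    · exact ⟨j.succ, fun i => Fin.cases h hj i⟩
    · exact ⟨0, fun i => Fin.cases ((htot _ _).elim id id) (fun i => relDvd_trans (hj i) h) i⟩

/-- Any `n + 1` elements of `B` are linearly dependent over `A` modulo the prime `Q`. -/
def Dep (A : Type u) {B : Type v} [CommRing A] [CommRing B] [Algebra A B] (Q : Ideal B) (n : ℕ) :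
    Prop :=
  ∀ b : Fin (n + 1) → B, ∃ a : Fin (n + 1) → A, (∃ i, algebraMap A B (a i) ∉ Q) ∧
    ∑ i, algebraMap A B (a i) * b i ∈ Q

lemma dep_step {A : Type u} {B : Type v} [CommRing A] [CommRing B] [Algebra A B]
    (Q Q' : Ideal B) [Q.IsPrime] [Q'.IsPrime] (hle : Q ≤ Q') (n : ℕ)
    (htot : ∀ a b, RelDvd (Q.comap (algebraMap A B)) (Q'.comap (algebraMap A B)) a b ∨
      RelDvd (Q.comap (algebraMap A B)) (Q'.comap (algebraMap A B)) b a)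
    (h : Dep A Q n) : Dep A Q' n := by
  classical
  intro b
  obtain ⟨a, ⟨i₀, hi₀⟩, hsum⟩ := h b
  obtain ⟨j, hj⟩ := exists_relDvd_all htot n a
  choose t c ht hm using hj
  have haj : algebraMap A B (a j) ∉ Q := by
    intro haj
    have h1 : t i₀ * a i₀ ∈ Q.comap (algebraMap A B) := by
      have := Ideal.add_mem _ (hm i₀) (Ideal.mul_mem_right (c i₀) _
        (show a j ∈ Q.comap (algebraMap A B) from haj))
      simpa using this
    rcases Ideal.IsPrime.mem_or_mem inferInstance h1 with h1 | h1
    · exact ht i₀ (hle h1)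
    · exact hi₀ h1
  have hprod : ∀ s : Finset (Fin (n + 1)), ∏ i ∈ s, t i ∉ Q'.comap (algebraMap A B) := by
    intro s hs
    obtain ⟨i, -, hi⟩ := (Ideal.IsPrime.prod_mem_iff (p := Q'.comap (algebraMap A B))).mp hs
    exact ht i hi
  let c' : Fin (n + 1) → A := fun i => if i = j then ∏ i, t i else (∏ k ∈ Finset.univ.erase i, t k) * c i
  refine ⟨c', ⟨j, ?_⟩, ?_⟩
  · simp only [c', if_pos]
    exact hprod _
  · apply hle
    have h2 : algebraMap A B (a j) * ∑ i, algebraMap A B (c' i) * b i ∈ Q := by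
      have h3 : ∑ i, (algebraMap A B ((∏ k, t k) * a i - a j * c' i) * b i) ∈ Q := by
        refine Ideal.sum_mem _ fun i _ => Ideal.mul_mem_right _ _ ?_
        by_cases hij : i = j
        · subst hij
          simp [c', mul_comm]
        · simp only [c', if_neg hij]
          rw [← Finset.mul_prod_erase Finset.univ t (Finset.mem_univ i)]
          have := Ideal.mul_mem_left Q (algebraMap A B (∏ k ∈ Finset.univ.erase i, t k)) (hm i)
          rw [← map_mul] at this
          convert this using 2
          ring
      have h4 := Ideal.mul_mem_left Q (algebraMap A B (∏ k, t k)) hsum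
      convert Q.sub_mem h4 h3 using 1
      simp only [Finset.mul_sum, ← Finset.sum_sub_distrib]
      refine Finset.sum_congr rfl fun i _ => ?_
      simp only [map_sub, map_mul]
      ring
    exact (Ideal.IsPrime.mem_or_mem inferInstance h2).resolve_left haj

lemma dep_of_ch {A : Type u} {B : Type v} [CommRing A] [CommRing B] [Algebra A B] [IsDomain A]
    [IsDomain B] [Algebra.IsIntegral A B] [Algebra.HasGoingDown A B]
    (p : Ideal A) [p.IsPrime] [IsNoetherianRing (Localization.AtPrime p)] (n : ℕ)
    (h0 : Dep A (⊥ : Ideal B) n) (J : Ideal (Localization.AtPrime p)) (hJ : Ch _ J) :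
    ∀ Q : Ideal B, Q.IsPrime → Q.comap (algebraMap A B) = J.comap (algebraMap A _) → Dep A Q n := by
  induction hJ with
  | bot _ =>
    intro Q hQ he
    have : Q = ⊥ := by
      apply Ideal.eq_bot_of_comap_eq_bot (R := A)
      rw [he, ← RingHom.ker_eq_comap_bot, RingHom.ker_eq_bot_iff_eq_zero]
      intro a ha
      rwa [IsLocalization.to_map_eq_zero_iff (M := p.primeCompl) _
        p.primeCompl_le_nonZeroDivisors] at ha
    rwa [this]
  | step P x hP hx ih =>
    intro Q' hQ' he
    have hPp := hP.isPrime
    have : Q'.LiesOver ((P ⊔ Ideal.span {x}).comap (algebraMap A (Localization.AtPrime p))) :=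
      ⟨he.symm⟩
    have hle : P.comap (algebraMap A (Localization.AtPrime p)) ≤
      (P ⊔ Ideal.span {x}).comap (algebraMap A (Localization.AtPrime p)) :=
      Ideal.comap_mono le_sup_left
    obtain ⟨Q, hQQ, hQp, hQo⟩ := Ideal.exists_ideal_le_liesOver_of_le Q' hle
    have he' : Q.comap (algebraMap A B) = P.comap (algebraMap A (Localization.AtPrime p)) :=
      hQo.over.symm
    refine dep_step Q Q' hQQ n ?_ (ih Q hQp he')
    rw [he, he']
    intro a b
    exact (relDvd_total P x hx _ _).imp (relDvd_comap p _ _ a b) (relDvd_comap p _ _ b a)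

lemma fracMap_algebraMap {A : Type u} {B : Type v} [CommRing A] [IsDomain A] [CommRing B]
    [IsDomain B] (f : A →+* B) (hf : Function.Injective f) (a : A) :
    f.fracMap hf (algebraMap A _ a) = algebraMap B _ (f a) := by
  simp [RingHom.fracMap]

lemma dep_bot_of_fracRank_le {A : Type u} {B : Type v} [CommRing A] [IsDomain A] [CommRing B]
    [IsDomain B] [Algebra A B] (hf : Function.Injective (algebraMap A B)) (n : ℕ)
    (h : fracRank (algebraMap A B) hf ≤ n) : Dep A (⊥ : Ideal B) n := by
  intro b
  letI := ((algebraMap A B).fracMap hf).toAlgebra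
  have hdep : ¬ LinearIndependent (FractionRing A) (fun i => algebraMap B (FractionRing B) (b i)) := by
    intro hli
    have h1 := hli.cardinal_lift_le_rank
    have h2 : Module.rank (FractionRing A) (FractionRing B) ≤ n := h
    have h3 := h1.trans (Cardinal.lift_le.mpr h2)
    simp only [Cardinal.mk_fin, Cardinal.lift_natCast] at h3
    have : n + 1 ≤ n := by exact_mod_cast h3
    omega
  obtain ⟨g, hg, i, hi⟩ := Fintype.not_linearIndependent_iff.mp hdep
  obtain ⟨s, hs⟩ := IsLocalization.exist_integer_multiples_of_finite (nonZeroDivisors A) g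
  choose a ha using hs
  have hs0 : algebraMap A (FractionRing A) s ≠ 0 := IsLocalization.to_map_ne_zero_of_mem_nonZeroDivisors _ le_rfl s.2
  refine ⟨a, ⟨i, ?_⟩, ?_⟩
  · rw [Ideal.mem_bot, map_eq_zero_iff _ hf]
    intro h0
    have := ha i
    rw [h0, map_zero, Algebra.smul_def] at this
    exact (mul_ne_zero hs0 hi) this.symm
  · rw [Ideal.mem_bot]
    apply IsFractionRing.injective B (FractionRing B)
    rw [map_zero, map_sum, ← mul_zero ((algebraMap A B).fracMap hf (algebraMap A _ s)), ← hg,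
      Finset.mul_sum]
    refine Finset.sum_congr rfl fun i _ => ?_
    rw [map_mul, ← fracMap_algebraMap _ hf, ha i, Algebra.smul_def, map_mul, Algebra.smul_def,
      mul_assoc]
    rfl

lemma fracRank_le_of_dep {A : Type u} {B : Type v} [CommRing A] [IsDomain A] [CommRing B]
    [IsDomain B] (f : A →+* B) (hf : Function.Injective f) (n : ℕ)
    (h : ∀ b : Fin (n + 1) → B, ∃ a : Fin (n + 1) → A, (∃ i, a i ≠ 0) ∧ ∑ i, f (a i) * b i = 0) :
    fracRank f hf ≤ n := by
  letI := (f.fracMap hf).toAlgebra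
  change Module.rank (FractionRing A) (FractionRing B) ≤ n
  refine rank_le fun s hs => ?_
  by_contra! hcard
  obtain ⟨e⟩ : Nonempty (Fin (n + 1) ↪ s) := by
    rw [Function.Embedding.nonempty_iff_card_le]; simpa using hcard
  have hli := hs.comp e e.injective
  set v : Fin (n + 1) → FractionRing B := (fun i : s => (i : FractionRing B)) ∘ e
  obtain ⟨d, hd⟩ := IsLocalization.exist_integer_multiples_of_finite (nonZeroDivisors B) v
  choose b hb using hd
  have hd0 : algebraMap B (FractionRing B) d ≠ 0 := IsLocalization.to_map_ne_zero_of_mem_nonZeroDivisors _ le_rfl d.2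
  obtain ⟨a, ⟨i, hi⟩, hsum⟩ := h b
  have := Fintype.linearIndependent_iff.mp hli (fun i => algebraMap A _ (a i)) (by
    apply mul_left_cancel₀ hd0
    rw [mul_zero, ← map_zero (algebraMap B (FractionRing B)), ← hsum, map_sum, Finset.mul_sum]
    refine Finset.sum_congr rfl fun i _ => ?_
    rw [map_mul, hb i, ← fracMap_algebraMap f hf, Algebra.smul_def, Algebra.smul_def,
      mul_left_comm]
    rfl) i
  exact hi ((map_eq_zero_iff _ (IsFractionRing.injective A (FractionRing A))).mp this)

lemma fracFinite_of_fracRank_le {A : Type u} {B : Type v} [CommRing A] [IsDomain A] [CommRing B]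
    [IsDomain B] (f : A →+* B) (hf : Function.Injective f) (n : ℕ) (h : fracRank f hf ≤ n) :
    FracFinite f hf := by
  letI := (f.fracMap hf).toAlgebra
  have h2 : Module.rank (FractionRing A) (FractionRing B) ≤ n := h
  exact Module.rank_lt_aleph0_iff.mp (h2.trans_lt Cardinal.natCast_lt_aleph0)

/-- Let `A ⊆ B` be an extension of integral domains with `B` integral over `A`
and `A` integrally closed.  Let `q` be a prime of `B` and `p = q ∩ A`.  If the localization
`A_p` is a regular local ring and `K(B)/K(A)` is finite, then `κ(q)/κ(p)` is finite and
`[κ(q) : κ(p)] ≤ [K(B) : K(A)]`. -/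
theorem residue_degree_le_of_regular
    (A : Type u) (B : Type v) [CommRing A] [IsDomain A] [CommRing B] [IsDomain B]
    [Algebra A B] (hAB : Function.Injective (algebraMap A B))
    [Algebra.IsIntegral A B] [IsIntegrallyClosed A]
    (q : Ideal B) (hq : q.IsPrime)
    (hreg : haveI := hq; IsRegularLocal (Localization.AtPrime (q.comap (algebraMap A B))))
    (hfin : FracFinite (algebraMap A B) hAB) :
    ResidueFinite A q hq ∧
      residueRank A q hq ≤ fracRank (algebraMap A B) hAB := by
  haveI := hq
  haveI : FaithfulSMul A B := (faithfulSMul_iff_algebraMap_injective A B).mpr hAB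
  obtain ⟨n, hn⟩ : ∃ n : ℕ, fracRank (algebraMap A B) hAB = n := by
    letI := ((algebraMap A B).fracMap hAB).toAlgebra
    haveI : Module.Finite (FractionRing A) (FractionRing B) := hfin
    exact ⟨Module.finrank (FractionRing A) (FractionRing B), (Module.finrank_eq_rank _ _).symm⟩
  obtain ⟨d, hd⟩ := regN_of_isRegularLocal hreg
  haveI : IsNoetherianRing (Localization.AtPrime (q.comap (algebraMap A B))) := hreg.1
  have hdep : Dep A q n := by
    refine dep_of_ch (q.comap (algebraMap A B)) n (dep_bot_of_fracRank_le hAB n hn.le)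
      _ (ch_of_regN d _ hd) q hq ?_
    exact (IsLocalization.AtPrime.comap_maximalIdeal
      (Localization.AtPrime (q.comap (algebraMap A B))) (q.comap (algebraMap A B))).symm
  have hrank : residueRank A q hq ≤ n := by
    refine fracRank_le_of_dep (Ideal.quotientMap q (algebraMap A B) le_rfl)
      Ideal.quotientMap_injective n ?_
    intro b
    choose b' hb' using fun i => Ideal.Quotient.mk_surjective (b i)
    obtain ⟨a, ⟨i, hi⟩, hsum⟩ := hdep b'
    refine ⟨fun i => Ideal.Quotient.mk _ (a i), ⟨i, ?_⟩, ?_⟩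
    · intro h
      exact hi (Ideal.mem_comap.mp (Ideal.Quotient.eq_zero_iff_mem.mp h))
    · rw [← Ideal.Quotient.eq_zero_iff_mem, map_sum] at hsum
      rw [← hsum]
      refine Finset.sum_congr rfl fun i _ => ?_
      rw [Ideal.quotientMap_mk, map_mul, hb']
  refine ⟨?_, hn ▸ hrank⟩
  exact fracFinite_of_fracRank_le (Ideal.quotientMap q (algebraMap A B) le_rfl)
    Ideal.quotientMap_injective n hrank

end
end

section
/- Let A ⊆ B be an extension of commutative integral domains such that B is integral over A and A is integrally closed. Let p be a prime ideal of A such that the localization A_p is a regular local ring, and assume n := [K(B) : K(A)] is finite. Then for any finitely many pairwise distinct prime ideals q_1, …, q_s of B with q_i ∩ A = p for all i, one has Σ_{i=1}^{s} [κ(q_i) : κ(p)] ≤ n. -/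
noncomputable section

open Ideal

universe u v

open MvPolynomial in
lemma analytic_indep {R : Type*} [CommRing R] [IsNoetherianRing R] (q : Ideal R) [hq : q.IsPrime]
    (d e : ℕ) (x : Fin d → R) (hmin : q ∈ (Ideal.span (Set.range x)).minimalPrimes)
    (hht : (d : ℕ∞) ≤ q.height) (F : MvPolynomial (Fin d) R) (hF : F.IsHomogeneous e)
    (h0 : MvPolynomial.eval x F = 0) (μ : Fin d →₀ ℕ) : F.coeff μ ∈ q := by
  cases d with
  | zero =>
    rw [eq_C_of_isEmpty F] at h0
    rw [Subsingleton.elim μ 0]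
    simp only [eval_C] at h0
    rw [h0]; exact q.zero_mem
  | succ d =>
    by_contra hμ
    let Q : Ideal (MvPolynomial (Fin (d+1)) R) := RingHom.ker (MvPolynomial.map (Ideal.Quotient.mk q))
    have hmem : ∀ G, G ∈ Q ↔ ∀ ν, coeff ν G ∈ q := by
      intro G
      simp only [Q, RingHom.mem_ker, MvPolynomial.ext_iff, coeff_map, coeff_zero,
        Ideal.Quotient.eq_zero_iff_mem]
    have : Q.IsPrime := RingHom.ker_isPrime _
    have hCQ : ∀ r, C r ∈ Q ↔ r ∈ q := by
      intro r
      simp [Q, RingHom.mem_ker, Ideal.Quotient.eq_zero_iff_mem]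
    have : Q.LiesOver q := ⟨by ext r; exact (hCQ r).symm⟩
    have hQht : q.height ≤ Q.height := by
      rw [Ideal.height_eq_height_add_of_liesOver_of_hasGoingDown q Q]
      exact le_self_add
    have hFQ : F ∉ Q := fun h => hμ ((hmem F).1 h μ)
    have hXQ : X (0 : Fin (d+1)) ∉ Q := by
      simp [Q, RingHom.mem_ker]
    let y : Fin d → MvPolynomial (Fin (d+1)) R := fun i =>
      X 0 * C (x i.succ) - X i.succ * C (x 0)
    let J : Ideal (MvPolynomial (Fin (d+1)) R) := Ideal.span (Set.range y)
    have hJ : ∀ i : Fin (d+1), X 0 * C (x i) - X i * C (x 0) ∈ J := by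
      intro i
      refine Fin.cases ?_ (fun i => ?_) i
      · simp
      · exact Ideal.subset_span ⟨i, rfl⟩
    have hkey : C (x 0) ^ e * F ∈ J := by
      have h1 : Ideal.Quotient.mk J (C (x 0) ^ e * F) =
          Ideal.Quotient.mk J ((X 0 : MvPolynomial (Fin (d+1)) R) ^ e * C (eval x F)) := by
        have hs : ∀ z : Fin (d+1) → MvPolynomial (Fin (d+1)) R, ∀ t,
            eval₂ C (fun i => t * z i) F = t ^ e * eval₂ C z F := by
          intro z t
          rw [eval₂_eq, eval₂_eq, Finset.mul_sum]
          refine Finset.sum_congr rfl fun ν hν => ?_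
          have : ∑ i, ν i = e := by
            have := hF.degree_eq_sum_deg_support hν
            rw [this]
            exact (Finset.sum_subset (Finset.subset_univ _) (by simp)).symm
          simp only [mul_pow, Finset.prod_mul_distrib]
          rw [Finset.prod_pow_eq_pow_sum, show ∑ i ∈ ν.support, ν i = e from by
            rw [← this]; exact Finset.sum_subset (Finset.subset_univ _) (by simp)]
          ring
        have e1 : C (x 0) ^ e * F = eval₂ C (fun i => C (x 0) * X i) F := by
          rw [hs, eval₂_eta]
        have e2 : (X 0 : MvPolynomial (Fin (d+1)) R) ^ e * C (eval x F) = eval₂ C (fun i => X 0 * C (x i)) F := by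
          rw [hs (fun i => C (x i))]; congr 1
          rw [← eval₂_id]
          exact (eval₂_comp_left C (RingHom.id R) x F)
        rw [e1, e2, eval₂_comp_left, eval₂_comp_left]
        congr 1
        funext i
        simp only [Function.comp_apply]
        refine ((Ideal.Quotient.eq).2 ?_).symm
        rw [mul_comm (C (x 0))]
        exact hJ i
      rw [h0] at h1
      rw [C_0, mul_zero, map_zero] at h1
      exact Ideal.Quotient.eq_zero_iff_mem.1 h1
    have hQmin : Q ∈ J.minimalPrimes := by
      have hxq : ∀ i, x i ∈ q := fun i => hmin.1.2 (Ideal.subset_span ⟨i, rfl⟩)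
      refine ⟨⟨inferInstance, ?_⟩, ?_⟩
      · rw [Ideal.span_le]
        rintro _ ⟨i, rfl⟩
        exact Q.sub_mem (Q.mul_mem_left _ ((hCQ _).2 (hxq _)))
          (Q.mul_mem_left _ ((hCQ _).2 (hxq _)))
      · rintro P ⟨hP, hJP⟩ hPQ
        have hx0 : C (x 0) ∈ P := by
          rcases hP.mem_or_mem (hJP hkey) with h | h
          · exact hP.mem_of_pow_mem _ h
          · exact (hFQ (hPQ h)).elim
        have hx : ∀ i, C (x i) ∈ P := by
          intro i
          have := P.add_mem (hJP (hJ i)) (P.mul_mem_left (X i) hx0)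
          rw [sub_add_cancel] at this
          exact (hP.mem_or_mem this).resolve_left fun h => hXQ (hPQ h)
        have hqP : q ≤ P.comap C := by
          refine hmin.2 ⟨hP.comap C, ?_⟩ ?_
          · rw [Ideal.span_le]
            rintro _ ⟨i, rfl⟩
            exact hx i
          · intro r hr
            exact (hCQ r).1 (hPQ hr)
        intro G hG
        rw [G.as_sum]
        refine P.sum_mem fun ν _ => ?_
        rw [← mul_one (coeff ν G), ← C_mul_monomial]
        exact P.mul_mem_right _ (hqP ((hmem G).1 hG ν))
    have h2 := Ideal.height_le_card_of_mem_minimalPrimes_span (Set.finite_range y) hQmin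
    have h3 : (Set.range y).ncard ≤ d := by
      have := Set.ncard_image_le (f := y) (s := Set.univ) 
      simpa using this
    have h4 : ((d+1 : ℕ) : ℕ∞) ≤ (d : ℕ∞) :=
      (hht.trans hQht).trans (h2.trans (by exact_mod_cast h3))
    have : d + 1 ≤ d := by exact_mod_cast h4
    omega

open MvPolynomial in
lemma eval_mem_pow_succ {A ι : Type*} [CommRing A] (m : Ideal A) (x : ι → A)
    (hx : ∀ i, x i ∈ m) (e : ℕ) (F : MvPolynomial ι A) (hF : F.IsHomogeneous e)
    (hc : ∀ μ, F.coeff μ ∈ m) : eval x F ∈ m ^ (e + 1) := by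
  rw [eval_eq]
  refine Ideal.sum_mem _ fun ν hν => ?_
  rw [pow_succ, mul_comm (m ^ e)]
  refine Ideal.mul_mem_mul (hc ν) ?_
  rw [hF.degree_eq_sum_deg_support hν]
  rw [← Finset.prod_pow_eq_pow_sum]
  exact Ideal.prod_mem_prod fun i _ => Ideal.pow_mem_pow (hx i) _

open MvPolynomial in
lemma core_local {A B ι κ : Type*} [CommRing A] [IsDomain A] [IsLocalRing A] [IsNoetherianRing A]
    [IsIntegrallyClosed A] [CommRing B] [IsDomain B] [Algebra A B] [FaithfulSMul A B]
    [Algebra.IsIntegral A B] (d : ℕ) (x : Fin d → A)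
    (hx : Ideal.span (Set.range x) = IsLocalRing.maximalIdeal A)
    (hd : (d : ℕ∞) ≤ (IsLocalRing.maximalIdeal A).height)
    (q : κ → Ideal B) (hq : ∀ i, (q i).IsPrime)
    (hover : ∀ i, (q i).comap (algebraMap A B) = IsLocalRing.maximalIdeal A)
    [Fintype ι] (v : ι → B)
    (hv : ∀ c : ι → A, (∀ i, ∑ j, c j • v j ∈ q i) → ∀ j, c j ∈ IsLocalRing.maximalIdeal A)
    (a : ι → A) (ha : ∑ j, a j • v j = 0) (j₀ : ι) : a j₀ = 0 := by
  classical
  by_contra hne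
  set m := IsLocalRing.maximalIdeal A with hm
  have hxm : ∀ i, x i ∈ m := fun i => by rw [← hx]; exact Ideal.subset_span ⟨i, rfl⟩
  -- order
  have hex : ∃ N, ∃ j, a j ∉ m ^ N := by
    by_contra! hcon
    apply hne
    have h : a j₀ ∈ ⨅ n : ℕ, m ^ n := (Ideal.mem_iInf).2 fun n => hcon n j₀
    rw [Ideal.iInf_pow_eq_bot_of_isLocalRing m Ideal.IsPrime.ne_top'] at h
    simpa using h
  obtain ⟨e, he1, j₁, he2⟩ : ∃ e, (∀ j, a j ∈ m ^ e) ∧ ∃ j, a j ∉ m ^ (e + 1) := by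
    have h1 := Nat.find_spec hex
    have h2 := fun k => Nat.find_min hex (m := k)
    cases hN : Nat.find hex with
    | zero => rw [hN] at h1; simp at h1
    | succ e =>
      rw [hN] at h1
      refine ⟨e, fun j => ?_, h1⟩
      have := h2 e (by omega)
      push Not at this
      exact this j
  have hF : ∀ j, ∃ p : MvPolynomial (Fin d) A, p.IsHomogeneous e ∧ p.eval x = a j := by
    intro j
    rw [← Ideal.mem_span_pow_iff_exists_isHomogeneous, hx]
    exact he1 j
  choose F hF1 hF2 using hF
  obtain ⟨μ, hμ⟩ : ∃ μ, (F j₁).coeff μ ∉ m := by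
    by_contra! hcon
    apply he2
    rw [← hF2]
    exact eval_mem_pow_succ m x hxm e _ (hF1 _) hcon
  obtain ⟨i, hi⟩ : ∃ i, ∑ j, (F j).coeff μ • v j ∉ q i := by
    by_contra! hcon
    exact hμ (hv _ hcon j₁)
  let B₀ := Algebra.adjoin A (Set.range v)
  have hfin : Module.Finite A B₀ :=
    Algebra.finite_adjoin_of_finite_of_isIntegral (Set.finite_range v)
      fun b _ => Algebra.IsIntegral.isIntegral b
  have hnoeth : IsNoetherianRing B₀ := IsNoetherianRing.of_finite A B₀
  have hfaith : FaithfulSMul A B₀ := by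
    rw [faithfulSMul_iff_algebraMap_injective]
    intro r s hrs
    apply FaithfulSMul.algebraMap_injective A B
    exact congrArg Subtype.val hrs
  have hint : Algebra.IsIntegral A B₀ := Algebra.IsIntegral.of_finite A B₀
  let q₀ : Ideal B₀ := (q i).comap B₀.val
  have hq₀ : q₀.IsPrime := (hq i).comap _
  have hunder : q₀.under A = m := by
    rw [← hover i]; rfl
  have hlies : q₀.LiesOver m := ⟨hunder.symm⟩
  have hmin := Ideal.IsIntegral.mem_minimalPrimes_map_under (R := A) q₀
  rw [hunder, ← hx, Ideal.map_span, ← Set.range_comp] at hmin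
  have hht : (d : ℕ∞) ≤ q₀.height := by
    rw [Ideal.height_eq_height_add_of_liesOver_of_hasGoingDown m q₀]
    exact hd.trans le_self_add
  let w : ι → B₀ := fun j => ⟨v j, Algebra.subset_adjoin ⟨j, rfl⟩⟩
  let G : MvPolynomial (Fin d) B₀ := ∑ j, C (w j) * map (algebraMap A B₀) (F j)
  have hG : G.IsHomogeneous e :=
    IsHomogeneous.sum _ _ _ fun j _ => ((hF1 j).map _).C_mul _
  have hGe : eval (algebraMap A B₀ ∘ x) G = 0 := by
    have : eval (algebraMap A B₀ ∘ x) G = ∑ j, a j • w j := by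
      simp only [G, map_sum, map_mul, eval_C]
      refine Finset.sum_congr rfl fun j _ => ?_
      rw [← hF2, Algebra.smul_def, mul_comm, eval_map, ← eval₂_id (g := x),
        eval₂_comp_left, RingHom.comp_id]
    rw [this]
    apply Subtype.ext
    simpa [w] using ha
  have := analytic_indep q₀ d e _ hmin hht G hG hGe μ
  apply hi
  have h2 : coeff μ G = ∑ j, (F j).coeff μ • w j := by
    simp only [G, coeff_sum, coeff_C_mul, coeff_map]
    refine Finset.sum_congr rfl fun j _ => ?_
    rw [Algebra.smul_def, mul_comm]
  rw [h2] at this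
  have h3 : B₀.val (∑ j, (F j).coeff μ • w j) ∈ q i := this
  simpa [w] using h3

lemma regular_generators (R : Type*) [CommRing R] [IsLocalRing R] (h : IsRegularLocal R) :
    ∃ (d : ℕ) (x : Fin d → R), Ideal.span (Set.range x) = IsLocalRing.maximalIdeal R ∧
      (d : ℕ∞) ≤ (IsLocalRing.maximalIdeal R).height := by
  obtain ⟨hN, hL, hdim⟩ := h
  have hne : {n : ℕ | ∃ s : Finset R, s.card = n ∧
        Ideal.span (s : Set R) = IsLocalRing.maximalIdeal R}.Nonempty := by
    obtain ⟨s, hs⟩ := IsNoetherian.noetherian (IsLocalRing.maximalIdeal R)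
    exact ⟨s.card, s, rfl, hs⟩
  obtain ⟨s, hs, hspan⟩ := Nat.sInf_mem hne
  refine ⟨s.card, fun i => (s.equivFin.symm i : R), ?_, ?_⟩
  · rw [← hspan]
    congr 1
    ext y
    constructor
    · rintro ⟨i, rfl⟩
      exact (s.equivFin.symm i).2
    · intro hy
      exact ⟨s.equivFin ⟨y, hy⟩, by simp⟩
  · rw [← hs, ← IsLocalRing.maximalIdeal_height_eq_ringKrullDim] at hdim
    exact le_of_eq (by exact_mod_cast hdim)

lemma core_global {A B ι κ : Type*} [CommRing A] [IsDomain A]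
    [IsIntegrallyClosed A] [CommRing B] [IsDomain B] [Algebra A B]
    (hAB : Function.Injective (algebraMap A B))
    [Algebra.IsIntegral A B] (P : Ideal A) [P.IsPrime]
    (hreg : IsRegularLocal (Localization.AtPrime P))
    (q : κ → Ideal B) (hq : ∀ i, (q i).IsPrime)
    (hover : ∀ i, (q i).comap (algebraMap A B) = P)
    [Fintype ι] (v : ι → B)
    (hv : ∀ c : ι → A, (∀ i, ∑ j, c j • v j ∈ q i) → ∀ j, c j ∈ P) :
    LinearIndependent A v := by
  rw [Fintype.linearIndependent_iff]
  intro a ha j₀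
  have hf : FaithfulSMul A B := (faithfulSMul_iff_algebraMap_injective A B).2 hAB
  let M := Algebra.algebraMapSubmonoid B P.primeCompl
  have hM : M ≤ nonZeroDivisors B :=
    algebraMapSubmonoid_le_nonZeroDivisors_of_faithfulSMul _ P.primeCompl_le_nonZeroDivisors
  let A' := Localization.AtPrime P
  let B' := Localization M
  have hdomA : IsDomain A' := inferInstance
  have hdomB : IsDomain B' := IsLocalization.isDomain_localization hM
  have hicA : IsIntegrallyClosed A' :=
    isIntegrallyClosed_of_isLocalization _ P.primeCompl P.primeCompl_le_nonZeroDivisors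
  have hintAB : Algebra.IsIntegral A' B' := ⟨isIntegral_localization (M := P.primeCompl)⟩
  have hinjA : Function.Injective (algebraMap A A') :=
    IsLocalization.injective _ P.primeCompl_le_nonZeroDivisors
  have hinjB : Function.Injective (algebraMap B B') := IsLocalization.injective _ hM
  have hinj : Function.Injective (algebraMap A' B') :=
    localizationAlgebra_injective (M := P.primeCompl) (S := B) A' B' hAB
  have hf' : FaithfulSMul A' B' := (faithfulSMul_iff_algebraMap_injective A' B').2 hinj
  have hnA : IsNoetherianRing A' := hreg.1
  obtain ⟨d, x, hx, hd⟩ := regular_generators A' hreg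
  have hdisj : ∀ i, Disjoint (M : Set B) (q i : Set B) := by
    intro i
    rw [Set.disjoint_left]
    rintro _ ⟨s, hs, rfl⟩ h
    apply hs
    rw [← hover i]
    exact h
  let q' : κ → Ideal B' := fun i => (q i).map (algebraMap B B')
  have hq' : ∀ i, (q' i).IsPrime := fun i =>
    IsLocalization.isPrime_of_isPrime_disjoint M B' _ (hq i) (hdisj i)
  have hcomapB : ∀ i, (q' i).comap (algebraMap B B') = q i := fun i =>
    IsLocalization.under_map_of_isPrime_disjoint M B' (hq i) (hdisj i)
  have hcomp : (algebraMap A' B').comp (algebraMap A A') =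
      (algebraMap B B').comp (algebraMap A B) := by
    rw [← IsScalarTower.algebraMap_eq, ← IsScalarTower.algebraMap_eq]
  have hcomapA : ∀ i, ((q' i).comap (algebraMap A' B')).comap (algebraMap A A') = P := by
    intro i
    rw [Ideal.comap_comap, hcomp, ← Ideal.comap_comap, hcomapB, hover]
  have hover' : ∀ i, (q' i).comap (algebraMap A' B') = IsLocalRing.maximalIdeal A' := by
    intro i
    have h := IsLocalization.map_under P.primeCompl A' ((q' i).comap (algebraMap A' B'))
    rw [Ideal.under_def, hcomapA, Localization.AtPrime.map_eq_maximalIdeal] at h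
    exact h.symm
  have hsm : ∀ c : ι → A, ∑ j, algebraMap A A' (c j) • algebraMap B B' (v j) =
      algebraMap B B' (∑ j, c j • v j) := by
    intro c
    rw [map_sum]
    refine Finset.sum_congr rfl fun j _ => ?_
    rw [Algebra.smul_def, Algebra.smul_def, map_mul]
    congr 1
    exact RingHom.congr_fun hcomp (c j)
  apply hinjA
  rw [map_zero]
  refine core_local d x hx hd q' hq' hover' (fun j => algebraMap B B' (v j)) ?_
    (fun j => algebraMap A A' (a j)) ?_ j₀
  · intro c hc j
    obtain ⟨s, hs⟩ := IsLocalization.exist_integer_multiples_of_finite P.primeCompl c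
    choose c₀ hc₀ using hs
    have hc₀P : ∀ j, c₀ j ∈ P := by
      apply hv
      intro i
      rw [← hcomapB i, Ideal.mem_comap, ← hsm]
      simp only [hc₀, smul_assoc, ← Finset.smul_sum]
      exact Submodule.smul_of_tower_mem _ _ (hc i)
    have h1 : algebraMap A A' (c₀ j) ∈ IsLocalRing.maximalIdeal A' := by
      rw [← Localization.AtPrime.map_eq_maximalIdeal]
      exact Ideal.mem_map_of_mem _ (hc₀P j)
    rw [hc₀, Algebra.smul_def] at h1
    exact ((Ideal.unit_mul_mem_iff_mem _ (IsLocalization.map_units A' s)).1 h1)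
  · rw [hsm, ha, map_zero]

lemma lift_indep {A : Type u} {B : Type v} {ι : Type*} [CommRing A] [CommRing B] [Algebra A B]
    (q : Ideal B) (hq : q.IsPrime) [Fintype ι] (w : ι → FractionRing (B ⧸ q))
    (hw : letI := residueAlgebra A q hq
      LinearIndependent (FractionRing (A ⧸ q.comap (algebraMap A B))) w) :
    ∃ b : ι → B, ∀ c : ι → A, ∑ j, c j • b j ∈ q → ∀ j, c j ∈ q.comap (algebraMap A B) := by
  letI := residueAlgebra A q hq
  obtain ⟨s, hs⟩ := IsLocalization.exist_integer_multiples_of_finite (nonZeroDivisors (B ⧸ q)) w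
  choose b' hb' using hs
  choose b hb using fun j => Ideal.Quotient.mk_surjective (b' j)
  refine ⟨b, fun c hc j => ?_⟩
  rw [Fintype.linearIndependent_iff] at hw
  have hmap : ∀ a : A, residueMap A q hq (algebraMap _ _
      (Ideal.Quotient.mk (q.comap (algebraMap A B)) a)) =
      algebraMap _ (FractionRing (B ⧸ q)) (Ideal.Quotient.mk q (algebraMap A B a)) := by
    intro a
    unfold residueMap RingHom.fracMap
    rw [IsFractionRing.lift_algebraMap]
    simp
  have hs0 : algebraMap (B ⧸ q) (FractionRing (B ⧸ q)) s ≠ 0 :=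
    (IsLocalization.map_units (FractionRing (B ⧸ q)) s).ne_zero
  have h := hw (fun j => algebraMap _ _ (Ideal.Quotient.mk (q.comap (algebraMap A B)) (c j))) (by
    apply mul_left_cancel₀ hs0
    rw [mul_zero, Finset.mul_sum]
    have h0 : algebraMap (B ⧸ q) (FractionRing (B ⧸ q))
        (Ideal.Quotient.mk q (∑ j, c j • b j)) = 0 := by
      rw [Ideal.Quotient.eq_zero_iff_mem.2 hc, map_zero]
    rw [← h0, map_sum, map_sum]
    refine Finset.sum_congr rfl fun k _ => ?_
    rw [Algebra.smul_def (c k), map_mul, map_mul, hb, hb', Algebra.smul_def (s : B ⧸ q)]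
    change _ * (residueMap A q hq _ * w k) = _
    rw [hmap]
    ring) j
  have h2 := (IsFractionRing.injective (A ⧸ q.comap (algebraMap A B)) _) (h.trans (map_zero _).symm)
  exact Ideal.Quotient.eq_zero_iff_mem.1 h2

lemma card_le_fracFinrank {A : Type u} {B : Type v} {ι : Type*} [CommRing A] [IsDomain A]
    [CommRing B] [IsDomain B] [Algebra A B] (hAB : Function.Injective (algebraMap A B))
    (hfin : FracFinite (algebraMap A B) hAB) [Fintype ι] (v : ι → B)
    (hv : LinearIndependent A v) : Fintype.card ι ≤ fracFinrank (algebraMap A B) hAB := by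
  letI := ((algebraMap A B).fracMap hAB).toAlgebra
  have hfin' : Module.Finite (FractionRing A) (FractionRing B) := hfin
  have htower : IsScalarTower A (FractionRing A) (FractionRing B) := by
    refine IsScalarTower.of_algebraMap_eq fun a => ?_
    change _ = (algebraMap A B).fracMap hAB (algebraMap A (FractionRing A) a)
    unfold RingHom.fracMap
    rw [IsFractionRing.lift_algebraMap, IsScalarTower.algebraMap_apply A B (FractionRing B)]
    rfl
  have h1 : LinearIndependent A (fun j => algebraMap B (FractionRing B) (v j)) :=
    hv.map' (IsScalarTower.toAlgHom A B (FractionRing B)).toLinearMap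
      (LinearMap.ker_eq_bot.2 (IsFractionRing.injective B (FractionRing B)))
  rw [LinearIndependent.iff_fractionRing A (FractionRing A)] at h1
  exact h1.fintype_card_le_finrank

lemma sum_card_le {A : Type u} {B : Type v} [CommRing A] [IsDomain A] [CommRing B] [IsDomain B]
    [Algebra A B] (hAB : Function.Injective (algebraMap A B))
    [Algebra.IsIntegral A B] [IsIntegrallyClosed A]
    (P : Ideal A) (hP : P.IsPrime)
    (hreg : IsRegularLocal (Localization.AtPrime P))
    (hfin : FracFinite (algebraMap A B) hAB)
    (s : ℕ) (Q : Fin s → Ideal B) (hQdist : Function.Injective Q)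
    (hQprime : ∀ i, (Q i).IsPrime)
    (hQover : ∀ i, (Q i).comap (algebraMap A B) = P)
    (r : Fin s → ℕ) (w : ∀ i, Fin (r i) → FractionRing (B ⧸ Q i))
    (hw : ∀ i, letI := residueAlgebra A (Q i) (hQprime i)
      LinearIndependent (FractionRing (A ⧸ (Q i).comap (algebraMap A B))) (w i)) :
    ∑ i, r i ≤ fracFinrank (algebraMap A B) hAB := by
  classical
  choose b hb using fun i => lift_indep (Q i) (hQprime i) (w i) (hw i)
  have ht : ∀ i, ∃ t : B, t ∉ Q i ∧ ∀ k, k ≠ i → t ∈ Q k := by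
    intro i
    have h1 : ∀ k, k ≠ i → ∃ t ∈ Q k, t ∉ Q i := by
      intro k hki
      by_contra! hcon
      have hlt : Q k < Q i := lt_of_le_of_ne hcon fun h => hki (hQdist h)
      have := hQprime k
      have := Ideal.IsIntegral.comap_lt_comap (R := A) hlt
      rw [hQover, hQover] at this
      exact lt_irrefl _ this
    choose! t ht1 ht2 using h1
    refine ⟨∏ k ∈ Finset.univ.erase i, t k, ?_, ?_⟩
    · intro h
      have := hQprime i
      obtain ⟨k, hk, hk2⟩ := (Ideal.IsPrime.prod_mem_iff).1 h
      exact ht2 k (Finset.ne_of_mem_erase hk) hk2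
    · intro k hk
      exact Ideal.mem_of_dvd _ (Finset.dvd_prod_of_mem t (Finset.mem_erase.2 ⟨hk, Finset.mem_univ _⟩))
        (ht1 k hk)
  choose t ht1 ht2 using ht
  have hLI : LinearIndependent A (fun j : (Σ i, Fin (r i)) => t j.1 * b j.1 j.2) := by
    refine core_global hAB P hreg Q hQprime hQover _ ?_
    rintro c hc ⟨k, j⟩
    rw [← hQover k]
    refine hb k (fun j => c ⟨k, j⟩) ?_ j
    have h1 := hc k
    rw [Fintype.sum_sigma, ← Finset.add_sum_erase _ _ (Finset.mem_univ k)] at h1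
    have h2 : ∑ i ∈ Finset.univ.erase k, ∑ j, c ⟨i, j⟩ • (t i * b i j) ∈ Q k := by
      refine Ideal.sum_mem _ fun i hi => Ideal.sum_mem _ fun j _ => ?_
      refine Submodule.smul_of_tower_mem _ _ ?_
      exact Ideal.mul_mem_right _ _ (ht2 i k (Finset.ne_of_mem_erase hi).symm)
    have h3 := (Ideal.add_mem_iff_left _ h2).1 h1
    have h4 : ∑ j, c ⟨k, j⟩ • (t k * b k j) = t k * ∑ j, c ⟨k, j⟩ • b k j := by
      rw [Finset.mul_sum]
      exact Finset.sum_congr rfl fun j _ => (mul_smul_comm _ _ _).symm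
    rw [h4] at h3
    exact ((hQprime k).mem_or_mem h3).resolve_left (ht1 k)
  have := card_le_fracFinrank hAB hfin _ hLI
  simpa using this

lemma finite_of_card_bound {K V : Type*} [Field K] [AddCommGroup V] [Module K V] (n : ℕ)
    (h : ∀ S : Finset V, LinearIndependent K (fun i : S => (i : V)) → S.card ≤ n) :
    Module.Finite K V :=
  Module.rank_lt_aleph0_iff.1 ((rank_le h).trans_lt (Cardinal.natCast_lt_aleph0))

/-- Let `A ⊆ B` be an extension of integral domains with `B` integral over `A`
and `A` integrally closed.  Let `P` be a prime of `A` such that `A_P` is a regular local ring,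
and assume `n = [K(B) : K(A)]` is finite.  Then for any finitely many pairwise distinct primes
`Q 0, …, Q (s-1)` of `B` lying over `P`, one has `∑ i, [κ(Q i) : κ(P)] ≤ n` (each residue
extension being finite). -/
theorem sum_residue_degrees_le
    (A : Type u) (B : Type v) [CommRing A] [IsDomain A] [CommRing B] [IsDomain B]
    [Algebra A B] (hAB : Function.Injective (algebraMap A B))
    [Algebra.IsIntegral A B] [IsIntegrallyClosed A]
    (P : Ideal A) (hP : P.IsPrime)
    (hreg : haveI := hP; IsRegularLocal (Localization.AtPrime P))
    (hfin : FracFinite (algebraMap A B) hAB)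
    (s : ℕ) (Q : Fin s → Ideal B) (hQdist : Function.Injective Q)
    (hQprime : ∀ i, (Q i).IsPrime)
    (hQover : ∀ i, (Q i).comap (algebraMap A B) = P) :
    (∀ i, ResidueFinite A (Q i) (hQprime i)) ∧
      ∑ i, residueFinrank A (Q i) (hQprime i) ≤ fracFinrank (algebraMap A B) hAB := by
  have key := sum_card_le hAB P hP hreg hfin s Q hQdist hQprime hQover
  have hfinite : ∀ i, ResidueFinite A (Q i) (hQprime i) := by
    intro i
    have := hQprime i
    letI := residueAlgebra A (Q i) (hQprime i)
    change Module.Finite (FractionRing (A ⧸ (Q i).comap (algebraMap A B)))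
      (FractionRing (B ⧸ Q i))
    have hprime : ((Q i).comap (algebraMap A B)).IsPrime := (hQprime i).comap _
    refine finite_of_card_bound (fracFinrank (algebraMap A B) hAB) fun S hS => ?_
    have hr := key (fun k => if k = i then S.card else 0) (fun k =>
      if h : k = i then fun j => by
        subst h
        exact (S.equivFin.symm (Fin.cast (by simp) j) : FractionRing (B ⧸ Q k))
      else fun j => Fin.elim0 (Fin.cast (by simp [h]) j)) (by
        intro k
        let _ := residueAlgebra A (Q k) (hQprime k)
        by_cases h : k = i
        · subst h
          simp only [dite_true]
          exact hS.comp _ (S.equivFin.symm.injective.comp (Fin.cast_injective _))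
        · have : IsEmpty (Fin (if k = i then S.card else 0)) := by
            rw [if_neg h]; infer_instance
          exact linearIndependent_empty_type)
    simpa using hr
  refine ⟨hfinite, ?_⟩
  have hbasis : ∀ i, ∃ w : Fin (residueFinrank A (Q i) (hQprime i)) → FractionRing (B ⧸ Q i),
      letI := residueAlgebra A (Q i) (hQprime i)
      LinearIndependent (FractionRing (A ⧸ (Q i).comap (algebraMap A B))) w := by
    intro i
    have := hQprime i
    letI := residueAlgebra A (Q i) (hQprime i)
    have hf : Module.Finite (FractionRing (A ⧸ (Q i).comap (algebraMap A B)))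
      (FractionRing (B ⧸ Q i)) := hfinite i
    exact ⟨_, (Module.finBasis (FractionRing (A ⧸ (Q i).comap (algebraMap A B)))
      (FractionRing (B ⧸ Q i))).linearIndependent⟩
  choose w hw using hbasis
  exact key _ w hw

end
end

section
/- Let A ⊆ B be an extension of commutative integral domains with B finitely generated as an A-module. Let p be a prime ideal of A and q a prime ideal of B with q ∩ A = p. Suppose that the localization A_p is a regular local ring and that [K(B) : K(A)] = [κ(q) : κ(p)] (both finite). Then the localization B_q is a regular local ring. -/
noncomputable section

open Ideal

universe u v

section helpers

open IsLocalRing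


lemma rl_exchange {R : Type u} [CommRing R] [IsLocalRing R] (s : Finset R)
    (hs : Ideal.span (s : Set R) = maximalIdeal R) (x : R) (hx : x ∈ maximalIdeal R)
    (hx2 : x ∉ maximalIdeal R ^ 2) :
    ∃ t : Finset R, t.card + 1 = s.card ∧
      maximalIdeal R = Ideal.span {x} ⊔ Ideal.span (t : Set R) := by
  classical
  rw [← hs] at hx
  obtain ⟨a, ha, hax⟩ := Submodule.mem_span_finset.1 hx
  obtain ⟨y, hy, hyu⟩ : ∃ y ∈ s, IsUnit (a y) := by
    by_contra! hcon
    apply hx2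
    rw [← hax, pow_two]
    refine Ideal.sum_mem _ fun y hy => ?_
    refine Ideal.mul_mem_mul ((mem_maximalIdeal _).2 (hcon y hy)) ?_
    rw [← hs]; exact Ideal.subset_span hy
  refine ⟨s.erase y, Finset.card_erase_add_one hy, le_antisymm ?_ ?_⟩
  · rw [← hs, Ideal.span_le]
    intro z hz
    by_cases hzy : z = y
    · subst hzy
      have h1 : a z * z ∈ Ideal.span {x} ⊔ Ideal.span ((s.erase z : Finset R) : Set R) := by
        have : a z * z = x - ∑ i ∈ s.erase z, a i • i := by
          rw [← hax, ← Finset.add_sum_erase _ _ hy]; simp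
        rw [this]
        refine Ideal.sub_mem _ (Ideal.mem_sup_left (Ideal.subset_span rfl)) (Ideal.mem_sup_right ?_)
        exact Ideal.sum_mem _ fun i hi => Ideal.mul_mem_left _ _ (Ideal.subset_span hi)
      exact (Ideal.unit_mul_mem_iff_mem _ hyu).1 h1
    · exact Ideal.mem_sup_right (Ideal.subset_span (by simp [hzy]; exact hz))
  · rw [← hs]
    refine sup_le ?_ (Ideal.span_mono (by simp))
    rwa [Ideal.span_le, Set.singleton_subset_iff]

lemma rl_step {R : Type u} [CommRing R] [IsLocalRing R] [IsNoetherianRing R] (d : ℕ) (s : Finset R)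
    (hs : Ideal.span (s : Set R) = maximalIdeal R) (hcard : s.card ≤ d + 1)
    (hd : ((d + 1 : ℕ) : WithBot ℕ∞) ≤ ringKrullDim R)
    (x : R) (hx : x ∈ maximalIdeal R)
    (hx2 : x ∉ maximalIdeal R ^ 2) :
    ∃ h : IsLocalRing (R ⧸ Ideal.span {x}), ∃ t : Finset (R ⧸ Ideal.span {x}), t.card ≤ d ∧
      Ideal.span (t : Set _) = maximalIdeal (R ⧸ Ideal.span {x}) ∧
      (d : WithBot ℕ∞) ≤ ringKrullDim (R ⧸ Ideal.span {x}) := by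
  classical
  obtain ⟨t, ht, hm⟩ := rl_exchange s hs x hx hx2
  have hne : Ideal.span {x} ≠ ⊤ := by
    intro h
    rw [Ideal.span_singleton_eq_top] at h
    exact hx h
  have : Nontrivial (R ⧸ Ideal.span {x}) := Ideal.Quotient.nontrivial_iff.2 hne
  have hloc : IsLocalRing (R ⧸ Ideal.span {x}) :=
    IsLocalRing.of_surjective' (Ideal.Quotient.mk _) Ideal.Quotient.mk_surjective
  refine ⟨hloc, t.image (Ideal.Quotient.mk _), ?_, ?_, ?_⟩
  · exact Finset.card_image_le.trans (by omega)
  · rw [← IsLocalRing.map_maximalIdeal_of_surjective (Ideal.Quotient.mk (Ideal.span {x}))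
      Ideal.Quotient.mk_surjective, hm, Ideal.map_sup, Ideal.map_quotient_self, Finset.coe_image,
      ← Ideal.map_span, bot_sup_eq]
  · have h1 := ringKrullDim_le_ringKrullDim_quotient_add_encard ({x} : Set R)
      (by simpa [IsLocalRing.ringJacobson_eq_maximalIdeal] using hx)
    rw [Set.encard_singleton] at h1
    have h2 := hd.trans h1
    push_cast at h2
    exact ENat.WithBot.add_le_add_one_right_iff.1 h2

lemma rl_exists {R : Type u} [CommRing R] [IsLocalRing R] [IsNoetherianRing R] (d : ℕ)
    (hd : ((d + 1 : ℕ) : WithBot ℕ∞) ≤ ringKrullDim R) :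
    ∃ x ∈ maximalIdeal R, x ∉ maximalIdeal R ^ 2 ∧ ∀ P ∈ minimalPrimes R, x ∉ P := by
  by_contra! hcon
  have hfin : (insert (maximalIdeal R ^ 2) (minimalPrimes R)).Finite :=
    (minimalPrimes.finite_of_isNoetherianRing R).insert _
  have := (Ideal.subset_union_prime_finite hfin (f := id) (maximalIdeal R ^ 2)
    (maximalIdeal R ^ 2) (I := maximalIdeal R) (fun i hi h1 _ => by
      rcases hi with hi | hi
      · exact absurd hi h1
      · exact hi.1.1)).1 (by
      intro x hx
      simp only [Set.mem_iUnion]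
      by_cases h2 : x ∈ maximalIdeal R ^ 2
      · exact ⟨_, Set.mem_insert _ _, h2⟩
      · obtain ⟨P, hP, hxP⟩ := hcon x hx h2
        exact ⟨P, Set.mem_insert_of_mem _ hP, hxP⟩)
  have hkey : maximalIdeal R ∈ minimalPrimes R := by
    obtain ⟨I, hI, hle⟩ := this
    rcases hI with rfl | hI
    · have hbot : maximalIdeal R = ⊥ := by
        refine Submodule.eq_bot_of_le_smul_of_le_jacobson_bot (maximalIdeal R) _
          (IsNoetherian.noetherian _) ?_ (IsLocalRing.maximalIdeal_le_jacobson _)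
        rw [smul_eq_mul, ← pow_two]; exact hle
      rw [hbot]
      have : (⊥ : Ideal R).IsPrime := hbot ▸ (inferInstance : (maximalIdeal R).IsPrime)
      exact ⟨⟨this, le_rfl⟩, fun _ _ _ => bot_le⟩
    · have := hI.1.1
      have : I = maximalIdeal R := le_antisymm (IsLocalRing.le_maximalIdeal this.ne_top) hle
      rwa [← this]
  have h0 : (maximalIdeal R).height = 0 := Ideal.height_eq_zero_iff.2 hkey
  rw [← IsLocalRing.maximalIdeal_height_eq_ringKrullDim, h0] at hd
  norm_cast at hd

lemma rl_domain (d : ℕ) : ∀ (R : Type u) [CommRing R] [IsLocalRing R] [IsNoetherianRing R]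
    (s : Finset R) (_ : Ideal.span (s : Set R) = maximalIdeal R) (_ : s.card ≤ d)
    (_ : (d : WithBot ℕ∞) ≤ ringKrullDim R), IsDomain R := by
  induction d with
  | zero =>
    intro R _ _ _ s hs hc _
    have : s = ∅ := by simpa using hc
    subst this
    have hb : maximalIdeal R = ⊥ := by rw [← hs]; simp
    exact (IsLocalRing.isField_iff_maximalIdeal_eq.2 hb).isDomain
  | succ d ih =>
    intro R _ _ _ s hs hc hd
    obtain ⟨x, hx, hx2, hP⟩ := rl_exists d hd
    obtain ⟨h, t, ht, hts, hdt⟩ := rl_step d s hs hc hd x hx hx2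
    have hdom := ih _ t hts ht hdt
    have hpr : (Ideal.span {x}).IsPrime := (Ideal.Quotient.isDomain_iff_prime _).1 hdom
    obtain ⟨P, hPm, hPx⟩ := Ideal.exists_minimalPrimes_le (bot_le (a := Ideal.span {x}))
    have hPp := hPm.1.1
    have hxP := hP P hPm
    have : P = ⊥ := by
      refine Submodule.eq_bot_of_le_smul_of_le_jacobson_bot (maximalIdeal R) _
          (IsNoetherian.noetherian _) ?_ (IsLocalRing.maximalIdeal_le_jacobson _)
      intro y hy
      obtain ⟨z, rfl⟩ := Ideal.mem_span_singleton.1 (hPx hy)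
      exact Ideal.mul_mem_mul hx ((hPp.mem_or_mem hy).resolve_left hxP)
    subst this
    exact IsDomain.of_bot_isPrime R


lemma rk_linInd {R : Type u} {T : Type v} [CommRing R] [IsDomain R] [IsNoetherianRing R]
    [AddCommGroup T] [Module R T] [Module.IsTorsionFree R T] (x : R) (hx : Prime x)
    {ι : Type*} [Fintype ι] (v : ι → T)
    (h : ∀ c : ι → R, (∃ t : T, ∑ i, c i • v i = x • t) → ∀ i, x ∣ c i) :
    LinearIndependent R v := by
  rw [Fintype.linearIndependent_iff]
  have key : ∀ e : ℕ, ∀ c : ι → R, ∑ i, c i • v i = 0 → ∀ i, x ^ e ∣ c i := by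
    intro e
    induction e with
    | zero => intro c _ i; simp
    | succ e ih =>
      intro c hc i
      choose c' hc' using h c ⟨0, by simpa using hc⟩
      have h0 : x • ∑ i, c' i • v i = 0 := by
        rw [Finset.smul_sum, ← hc]
        refine Finset.sum_congr rfl fun i _ => ?_
        rw [smul_smul, ← hc' i]
      have h1 : ∑ i, c' i • v i = 0 := (smul_eq_zero.1 h0).resolve_left hx.ne_zero
      rw [hc' i, pow_succ']
      exact mul_dvd_mul_left _ (ih c' h1 i)
  intro c hc i
  by_contra hne
  obtain ⟨n, hn⟩ := FiniteMultiplicity.of_not_isUnit hx.not_isUnit hne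
  exact hn (key _ c hc i)

/-- The saturation of `S` inside its fraction field. -/
def satAlg (R : Type u) (S : Type v) [CommRing R] [CommRing S] [IsDomain S] [Algebra R S]
    (x : R) (hx : Prime x) : Subalgebra S (FractionRing S) where
  carrier := {w | (∃ k : ℕ, ∃ s : S, x ^ k • w = algebraMap S _ s) ∧
    ∃ r : R, ¬ x ∣ r ∧ ∃ s : S, r • w = algebraMap S _ s}
  mul_mem' := by
    rintro a b ⟨⟨k, s, hs⟩, r, hr, s', hs'⟩ ⟨⟨k2, s2, hs2⟩, r2, hr2, s2', hs2'⟩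
    refine ⟨⟨k + k2, s * s2, ?_⟩, r * r2, fun h => ?_, s' * s2', ?_⟩
    · rw [map_mul, ← hs, ← hs2, smul_mul_smul_comm, pow_add]
    · exact (hx.dvd_or_dvd h).elim hr hr2
    · rw [map_mul, ← hs', ← hs2', smul_mul_smul_comm]
  add_mem' := by
    rintro a b ⟨⟨k, s, hs⟩, r, hr, s', hs'⟩ ⟨⟨k2, s2, hs2⟩, r2, hr2, s2', hs2'⟩
    have hsm : ∀ (r : R) (s : S), algebraMap S (FractionRing S) (r • s) = r • algebraMap S _ s :=
      fun r s => map_smul (IsScalarTower.toAlgHom R S (FractionRing S)) r s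
    refine ⟨⟨k + k2, x ^ k2 • s + x ^ k • s2, ?_⟩, r * r2, fun h => ?_, r2 • s' + r • s2', ?_⟩
    · rw [map_add, hsm, hsm, ← hs, ← hs2, smul_smul, smul_smul, smul_add, pow_add, mul_comm (x ^ k2)]
    · exact (hx.dvd_or_dvd h).elim hr hr2
    · rw [map_add, hsm, hsm, ← hs', ← hs2', smul_smul, smul_smul, smul_add, mul_comm r2]
  algebraMap_mem' := by
    intro s
    exact ⟨⟨0, s, by simp⟩, 1, fun h => hx.not_isUnit (isUnit_of_dvd_one h), s, by simp⟩

lemma satAlg_tf (R : Type u) (S : Type v) [CommRing R] [IsDomain R] [CommRing S] [IsDomain S]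
    [Algebra R S] [FaithfulSMul R S] (x : R) (hx : Prime x) (r : R) (hr : ¬ x ∣ r)
    (t t' : satAlg R S x hx) (h : r • t = x • t') : ∃ t'' : satAlg R S x hx, t = x • t'' := by
  have hx0 : algebraMap R (FractionRing S) x ≠ 0 := by
    rw [IsScalarTower.algebraMap_apply R S (FractionRing S)]
    intro h
    apply hx.ne_zero
    apply FaithfulSMul.algebraMap_injective R S
    apply IsFractionRing.injective S (FractionRing S)
    simpa using h
  obtain ⟨t, ⟨k, s, hs⟩, ht2⟩ := t
  obtain ⟨t', ht', r', hr', s', hs'⟩ := t'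
  have h' : r • t = x • t' := congrArg Subtype.val h
  have e1 : x • ((algebraMap R (FractionRing S) x)⁻¹ * t) = t := by
    rw [Algebra.smul_def, mul_inv_cancel_left₀ hx0]
  refine ⟨⟨(algebraMap R (FractionRing S) x)⁻¹ * t, ⟨k + 1, s, ?_⟩, r' * r, ?_, s', ?_⟩, ?_⟩
  · rw [pow_succ, mul_smul, e1, hs]
  · intro h; exact (hx.dvd_or_dvd h).elim hr' hr
  · rw [mul_smul, ← mul_smul_comm, h', ← hs', Algebra.smul_def x, inv_mul_cancel_left₀ hx0]
  · exact Subtype.ext e1.symm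

lemma rk_exists_free (R : Type u) (S : Type v) [CommRing R] [IsDomain R] [AddCommGroup S]
    [Module R S] [Module.Finite R S] :
    ∃ b : Set S, LinearIndepOn R id b ∧ ∃ d : R, d ≠ 0 ∧ ∀ s : S, d • s ∈ Submodule.span R b := by
  obtain ⟨b, hb, hli⟩ := exists_set_linearIndependent_of_isDomain R S
  refine ⟨b, hli, ?_⟩
  have h1 := rank_quotient_add_rank_of_isDomain (Submodule.span R b)
  have h2 : Module.rank R (Submodule.span R b) = Module.rank R S := by
    rw [rank_span_set hli, hb]
  rw [h2] at h1
  have h3 : Module.rank R (S ⧸ Submodule.span R b) = 0 := by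
    have : Module.rank R S < Cardinal.aleph0 := Module.rank_lt_aleph0 R S
    exact Cardinal.eq_of_add_eq_add_right (h1.trans (zero_add _).symm) this
  have h4 := Module.rank_eq_zero_iff_isTorsion.1 h3
  obtain ⟨d, hd1, hd2⟩ := Set.not_disjoint_iff.1 (Set.not_disjoint_iff_nonempty_inter.2
    (Submodule.annihilator_top_inter_nonZeroDivisors h4))
  refine ⟨d, nonZeroDivisors.ne_zero hd2, fun s => ?_⟩
  rw [← Submodule.Quotient.mk_eq_zero, Submodule.Quotient.mk_smul]
  exact Submodule.mem_annihilator.1 hd1 _ trivial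

lemma satAlg_bound (R : Type u) (S : Type v) [CommRing R] [IsDomain R] [CommRing S] [IsDomain S]
    [Algebra R S] [FaithfulSMul R S] [Module.Finite R S] (x : R) (hx : Prime x) :
    ∃ f : satAlg R S x hx →ₗ[R] S, Function.Injective f := by
  obtain ⟨b, hb, d, hd, hdS⟩ := rk_exists_free R S
  let φ : S →ₗ[R] FractionRing S := (IsScalarTower.toAlgHom R S (FractionRing S)).toLinearMap
  have hφ : Function.Injective φ := IsFractionRing.injective S (FractionRing S)
  have : Module.IsTorsionFree R (FractionRing S) := by
    have : FaithfulSMul R (FractionRing S) := FaithfulSMul.trans R S _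
    infer_instance
  have key : ∀ w : satAlg R S x hx, d • (w : FractionRing S) ∈ LinearMap.range φ := by
    rintro ⟨w, ⟨k, s, hs⟩, r, hr, s', hs'⟩
    obtain ⟨e, he⟩ : ∃ e : b →₀ R, Finsupp.linearCombination R (fun i : b => (i : S)) e = d • s := by
      have := hdS s
      rw [← LinearMap.mem_range, Finsupp.range_linearCombination]
      simpa using this
    obtain ⟨c, hc⟩ : ∃ c : b →₀ R, Finsupp.linearCombination R (fun i : b => (i : S)) c = d • s' := by
      have := hdS s'
      rw [← LinearMap.mem_range, Finsupp.range_linearCombination]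
      simpa using this
    have h1 : x ^ k • c = r • e := by
      apply (linearIndependent_iff_injective_finsuppLinearCombination.1 hb)
      simp only [map_smul]
      erw [he, hc]
      apply hφ
      simp only [map_smul]
      change x ^ k • d • algebraMap S _ s' = r • d • algebraMap S _ s
      rw [← hs, ← hs', smul_comm d r, smul_comm d (x^k), smul_comm (x^k) r]
    have h2 : ∀ i, x ^ k ∣ e i := by
      intro i
      have : x ^ k * c i = r * e i := DFunLike.congr_fun h1 i
      exact (hx.pow_dvd_of_dvd_mul_left k hr (Dvd.intro _ this))
    choose g hg using h2
    refine ⟨Finsupp.linearCombination R (fun i : b => (i : S)) (Finsupp.onFinset e.support g ?_), ?_⟩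
    · intro i hi
      simp only [Finsupp.mem_support_iff]
      rw [hg]
      exact mul_ne_zero (pow_ne_zero _ hx.ne_zero) hi
    · have hxk : x ^ k ≠ 0 := pow_ne_zero _ hx.ne_zero
      apply smul_right_injective _ hxk
      simp only
      rw [smul_comm (x^k) d, hs, ← map_smul, ← map_smul]
      have : x ^ k • Finsupp.onFinset e.support g (by
        intro i hi
        simp only [Finsupp.mem_support_iff]
        rw [hg]
        exact mul_ne_zero (pow_ne_zero _ hx.ne_zero) hi) = e := by
        ext i; simp [hg i]
      rw [this, he, map_smul]; rfl
  have hval : Function.Injective (fun w : satAlg R S x hx => d • (w : FractionRing S)) :=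
    (smul_right_injective _ hd).comp Subtype.val_injective
  let ψ : satAlg R S x hx →ₗ[R] FractionRing S :=
    { toFun := fun w => d • (w : FractionRing S)
      map_add' := fun a b => by simp
      map_smul' := fun r a => by
        change d • r • (a : FractionRing S) = r • d • (a : FractionRing S)
        rw [smul_comm] }
  let E := LinearEquiv.ofInjective φ hφ
  refine ⟨E.symm.toLinearMap ∘ₗ ψ.codRestrict (LinearMap.range φ) key, ?_⟩
  intro a a' h
  have := E.symm.injective h
  exact hval (congrArg Subtype.val this)


/-- rank comparison for reduction mod a prime element -/
lemma rk_reduce {R : Type u} {T : Type v} [CommRing R] [IsDomain R] [IsNoetherianRing R]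
    [CommRing T] [Algebra R T] [Module.IsTorsionFree R T] [Module.Finite R T]
    (x : R) (hx : Prime x)
    (tf : ∀ r : R, ¬ x ∣ r → ∀ t t' : T, r • t = x • t' → ∃ t'' : T, t = x • t'')
    (P : Ideal T) [P.LiesOver (Ideal.span {x})] :
    Module.finrank (R ⧸ Ideal.span {x}) (T ⧸ P) ≤ Module.finrank R T ∧
    (Module.finrank R T ≤ Module.finrank (R ⧸ Ideal.span {x}) (T ⧸ P) →
      ∀ p ∈ P, ∃ t : T, p = x • t) := by
  have hpr : (Ideal.span {x}).IsPrime := (Ideal.span_singleton_prime hx.ne_zero).2 hx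
  have hxP : ∀ t : T, x • t ∈ P := by
    intro t
    rw [Algebra.smul_def]
    apply Ideal.mul_mem_right
    have : x ∈ Ideal.span {x} := Ideal.subset_span rfl
    rwa [Ideal.mem_of_liesOver P (Ideal.span {x})] at this
  obtain ⟨b, hb, hli⟩ := exists_set_linearIndependent_of_isDomain (R ⧸ Ideal.span {x}) (T ⧸ P)
  have : Finite b := hli.finite
  have := Fintype.ofFinite b
  have hcard : Module.finrank (R ⧸ Ideal.span {x}) (T ⧸ P) = Fintype.card b := by
    rw [Module.finrank, ← hb]; simp
  choose v hv using fun i : b => Ideal.Quotient.mk_surjective (i : T ⧸ P)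
  have hmod : ∀ c : b → R, (∑ i, c i • v i) ∈ P → ∀ i, x ∣ c i := by
    intro c hc i
    have h1 := Fintype.linearIndependent_iff.1 hli (fun i => Ideal.Quotient.mk _ (c i)) (by
      have h2 := Ideal.Quotient.eq_zero_iff_mem.2 hc
      rw [map_sum] at h2
      rw [← h2]
      refine Finset.sum_congr rfl fun i _ => ?_
      rw [Algebra.smul_def, Algebra.smul_def, map_mul, hv]
      rfl) i
    rw [Ideal.Quotient.eq_zero_iff_mem, Ideal.mem_span_singleton] at h1
    exact h1
  rw [hcard]
  constructor
  · have := rk_linInd x hx v (fun c ⟨t, ht⟩ => hmod c (ht ▸ hxP t))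
    exact this.fintype_card_le_finrank
  · intro hle p hp
    by_contra hcon
    have := rk_linInd x hx (fun o : Option b => o.elim p v) (fun c ⟨t, ht⟩ => by
      rw [Fintype.sum_option] at ht
      simp only [Option.elim] at ht
      have h1 : ∀ i, x ∣ c (some i) := by
        apply hmod
        have : ∑ i, c (some i) • v i = x • t - c none • p := by rw [← ht]; ring
        rw [this]
        refine P.sub_mem (hxP t) ?_
        rw [Algebra.smul_def]
        exact P.mul_mem_left _ hp
      have h2 : x ∣ c none := by
        by_contra hn
        choose g hg using h1
        apply hcon
        refine tf _ hn p (t - ∑ i, g i • v i) ?_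
        rw [smul_sub, ← ht, Finset.smul_sum]
        simp only [smul_smul, ← hg]
        ring
      intro o
      cases o with
      | none => exact h2
      | some i => exact h1 i)
    have := this.fintype_card_le_finrank
    rw [Fintype.card_option] at this
    omega

lemma rk_step {R : Type u} {S : Type v} {T : Type v} [CommRing R] [IsDomain R] [IsLocalRing R]
    [IsNoetherianRing R] [CommRing S] [IsDomain S] [Algebra R S] [FaithfulSMul R S]
    [Module.Finite R S] [CommRing T] [IsDomain T] [Algebra R T] [Algebra S T]
    [IsScalarTower R S T] [Module.Finite R T] [FaithfulSMul S T] (x : R) (hx : Prime x)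
    (hxm : x ∈ maximalIdeal R) [IsLocalRing (R ⧸ Ideal.span {x})]
    (tf : ∀ r : R, ¬ x ∣ r → ∀ t t' : T, r • t = x • t' → ∃ t'' : T, t = x • t'')
    (hrank : Module.finrank R T ≤ Module.finrank R S)
    (ih : ∀ (P : Ideal T) (_ : P.IsPrime) (_ : P.LiesOver (Ideal.span {x}))
      (Q : Ideal (T ⧸ P)) (_ : Q.IsMaximal),
      Module.length (R ⧸ Ideal.span {x}) ((T ⧸ P) ⧸ Q) ≤
        Module.finrank (R ⧸ Ideal.span {x}) (T ⧸ P) ∧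
      ((Module.finrank (R ⧸ Ideal.span {x}) (T ⧸ P) : ℕ∞) ≤
        Module.length (R ⧸ Ideal.span {x}) ((T ⧸ P) ⧸ Q) →
      Q = (maximalIdeal (R ⧸ Ideal.span {x})).map (algebraMap _ (T ⧸ P))))
    (Q : Ideal S) (hQ : Q.IsMaximal) :
    Module.length R (S ⧸ Q) ≤ Module.finrank R S ∧
    ((Module.finrank R S : ℕ∞) ≤ Module.length R (S ⧸ Q) →
      Q = (maximalIdeal R).map (algebraMap R S)) := by
  have hST : Function.Injective (algebraMap S T) :=
    FaithfulSMul.algebraMap_injective _ _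
  have : FaithfulSMul R T := FaithfulSMul.trans R S T
  have : Algebra.IsIntegral S T := Algebra.IsIntegral.tower_top R
  obtain ⟨Q', hQ', hQQ⟩ := Ideal.exists_ideal_over_maximal_of_isIntegral (S := T) Q (by
    rw [(RingHom.injective_iff_ker_eq_bot _).1 hST]; exact bot_le)
  have hQ'm : Q'.comap (algebraMap R T) = maximalIdeal R :=
    IsLocalRing.eq_maximalIdeal (Ideal.isMaximal_comap_of_isIntegral_of_isMaximal Q')
  obtain ⟨P, hPmin, hPQ⟩ := Ideal.exists_minimalPrimes_le (I := Ideal.span {algebraMap R T x})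
    (J := Q') (by
      rw [Ideal.span_le, Set.singleton_subset_iff]
      have : x ∈ Q'.comap (algebraMap R T) := hQ'm ▸ hxm
      exact this)
  have hPp : P.IsPrime := hPmin.1.1
  have hxP : algebraMap R T x ∈ P := hPmin.1.2 (Ideal.subset_span rfl)
  have hPover : P.LiesOver (Ideal.span {x}) := by
    constructor
    apply le_antisymm
    · rw [Ideal.span_le, Set.singleton_subset_iff]; exact hxP
    · intro r hr
      by_contra hcon
      rw [Ideal.mem_span_singleton] at hcon
      obtain ⟨n, hn⟩ := Ideal.exists_mul_mem_of_mem_minimalPrimes hPmin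
        (show algebraMap R T r ∈ P from hr)
      obtain ⟨hn1, hn2⟩ := hn
      obtain ⟨y, hy⟩ := Ideal.mem_span_singleton.1 hn2
      obtain ⟨z, hz⟩ := tf r hcon n y (by rw [Algebra.smul_def, Algebra.smul_def, hy])
      apply hn1
      rw [hz, Algebra.smul_def]
      exact Ideal.mul_mem_right _ _ (Ideal.subset_span rfl)
  obtain ⟨hr1, hr2⟩ := rk_reduce (T := T) x hx tf P
  have hQmax : (Q'.map (Ideal.Quotient.mk P)).IsMaximal :=
    Ideal.IsMaximal.map_of_surjective_of_ker_le Ideal.Quotient.mk_surjective (by simpa)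
  obtain ⟨i1, i2⟩ := ih P hPp hPover (Q'.map (Ideal.Quotient.mk P)) hQmax
  have hlen : Module.length (R ⧸ Ideal.span {x}) ((T ⧸ P) ⧸ (Q'.map (Ideal.Quotient.mk P))) =
      Module.length R (T ⧸ Q') := by
    have e : ((T ⧸ P) ⧸ (Q'.map (Ideal.Quotient.mk P))) ≃ₗ[R] T ⧸ Q' :=
      (DoubleQuot.quotQuotEquivQuotOfLEₐ R hPQ).toLinearEquiv
    rw [← e.length_eq]
    have : IsScalarTower R (R ⧸ Ideal.span {x}) ((T ⧸ P) ⧸ (Q'.map (Ideal.Quotient.mk P))) := by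
      refine IsScalarTower.of_algebraMap_eq fun r => ?_
      rfl
    symm
    apply Module.length_eq_of_surjective
    exact Ideal.Quotient.mk_surjective
  let g : (S ⧸ Q) →ₐ[R] (T ⧸ Q') := Ideal.quotientMapₐ Q' (IsScalarTower.toAlgHom R S T) hQQ.ge
  have hg : Function.Injective g := Ideal.quotientMap_injective' (H := hQQ.ge) hQQ.le
  have hlg := Module.length_le_of_injective g.toLinearMap hg
  rw [hlen] at i1 i2
  refine ⟨hlg.trans (i1.trans (by exact_mod_cast hr1.trans hrank)), fun hle => ?_⟩
  have a1 := hle.trans (hlg.trans i1)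
  have a2 : Module.finrank R S ≤ Module.finrank (R ⧸ Ideal.span {x}) (T ⧸ P) := by
    exact_mod_cast a1
  have b1 := hr2 (hrank.trans a2)
  have b2 := i2 (le_trans (by exact_mod_cast hr1.trans hrank) (hle.trans hlg))
  have hQ'eq : Q' = (maximalIdeal R).map (algebraMap R T) := by
    have hc : (Q'.map (Ideal.Quotient.mk P)).comap (Ideal.Quotient.mk P) = Q' := by
      rw [Ideal.comap_map_of_surjective _ Ideal.Quotient.mk_surjective, ← RingHom.ker_eq_comap_bot,
        Ideal.mk_ker, sup_eq_left]
      exact hPQ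
    have hm : (maximalIdeal (R ⧸ Ideal.span {x})).map (algebraMap _ (T ⧸ P)) =
        ((maximalIdeal R).map (algebraMap R T)).map (Ideal.Quotient.mk P) := by
      rw [← IsLocalRing.map_maximalIdeal_of_surjective (Ideal.Quotient.mk (Ideal.span {x}))
        Ideal.Quotient.mk_surjective, Ideal.map_map, Ideal.map_map]
      rfl
    rw [← hc, b2, hm, Ideal.comap_map_of_surjective _ Ideal.Quotient.mk_surjective,
      ← RingHom.ker_eq_comap_bot, Ideal.mk_ker, sup_eq_left]
    intro p hp
    obtain ⟨t, rfl⟩ := b1 p hp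
    rw [Algebra.smul_def]
    exact Ideal.mul_mem_right _ _ (Ideal.mem_map_of_mem _ hxm)
  have hsurjg : Function.Surjective g := by
    have hfl : Module.length R (T ⧸ Q') ≠ ⊤ :=
      (i1.trans_lt (ENat.coe_lt_top _)).ne
    rw [Module.length_ne_top_iff, isFiniteLength_iff_isNoetherian_isArtinian] at hfl
    obtain ⟨_, _⟩ := hfl
    have h1 : LinearMap.range g.toLinearMap = ⊤ := by
      by_contra hne
      have h2 := Submodule.length_lt hne
      rw [← (LinearEquiv.ofInjective g.toLinearMap hg).length_eq] at h2
      have h3 : Module.length R (T ⧸ Q') ≤ Module.length R (S ⧸ Q) :=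
        i1.trans (le_trans (by exact_mod_cast hr1.trans hrank) hle)
      exact absurd h2 h3.not_gt
    exact LinearMap.range_eq_top.1 h1
  have hsurj : Function.Surjective (algebraMap S T) := by
    have h1 : (⊤ : Submodule R T) ≤ LinearMap.range (IsScalarTower.toAlgHom R S T).toLinearMap := by
      refine Submodule.le_of_le_smul_of_le_jacobson_bot (I := maximalIdeal R)
        Module.Finite.fg_top (IsLocalRing.maximalIdeal_le_jacobson _) ?_
      intro t _
      obtain ⟨y, hy⟩ := hsurjg (Ideal.Quotient.mk Q' t)
      obtain ⟨s, rfl⟩ := Ideal.Quotient.mk_surjective y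
      have h2 : t - algebraMap S T s ∈ Q' := by
        rw [← Ideal.Quotient.eq_zero_iff_mem, map_sub, ← hy, sub_eq_zero]
        rfl
      rw [← add_sub_cancel (algebraMap S T s) t]
      refine Submodule.add_mem_sup ⟨s, rfl⟩ ?_
      rw [hQ'eq] at h2
      rw [Ideal.smul_top_eq_map]
      exact h2
    intro t
    exact h1 (Submodule.mem_top (x := t))
  rw [← hQQ, hQ'eq, IsScalarTower.algebraMap_eq R S T, ← Ideal.map_map]
  exact Ideal.comap_map_of_bijective _ ⟨hST, hsurj⟩

theorem rk_main (d : ℕ) : ∀ (R : Type u) (S : Type v) [CommRing R] [IsDomain R] [IsLocalRing R]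
    [IsNoetherianRing R] [CommRing S] [IsDomain S] [Algebra R S] [FaithfulSMul R S]
    [Module.Finite R S] (s : Finset R) (_ : Ideal.span (s : Set R) = maximalIdeal R)
    (_ : s.card ≤ d) (_ : (d : WithBot ℕ∞) ≤ ringKrullDim R) (Q : Ideal S) (_ : Q.IsMaximal),
    Module.length R (S ⧸ Q) ≤ Module.finrank R S ∧
    ((Module.finrank R S : ℕ∞) ≤ Module.length R (S ⧸ Q) →
      Q = (maximalIdeal R).map (algebraMap R S)) := by
  induction d with
  | zero =>
    intro R S _ _ _ _ _ _ _ _ _ s hs hc _ Q hQ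
    have : s = ∅ := by simpa using hc
    subst this
    have hb : maximalIdeal R = ⊥ := by rw [← hs]; simp
    have hf := IsLocalRing.isField_iff_maximalIdeal_eq.2 hb
    have hSf : IsField S := isField_of_isIntegral_of_isField' hf
    let := hf.toField
    have hQb : Q = ⊥ := by
      let := hSf.toField
      exact (Ideal.eq_bot_or_top Q).resolve_right hQ.ne_top
    subst hQb
    refine ⟨?_, fun _ => by rw [hb, Ideal.map_bot]⟩
    have e : (S ⧸ (⊥ : Ideal S)) ≃ₗ[R] S := (AlgEquiv.quotientBot R S).toLinearEquiv
    rw [e.length_eq]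
    have := Module.length_eq_finrank R S
    exact this.le
  | succ d ih =>
    intro R S _ _ _ _ _ _ _ _ _ s hs hc hd Q hQ
    obtain ⟨x, hxm, hx2, hP⟩ := rl_exists d hd
    obtain ⟨hloc, t, ht, hts, hdt⟩ := rl_step d s hs hc hd x hxm hx2
    have hdom := rl_domain _ _ t hts ht hdt
    have hpr : (Ideal.span {x}).IsPrime := (Ideal.Quotient.isDomain_iff_prime _).1 hdom
    have hx0 : x ≠ 0 := fun h => hx2 (h ▸ zero_mem _)
    have hx : Prime x := (Ideal.span_singleton_prime hx0).1 hpr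
    obtain ⟨f, hf⟩ := satAlg_bound R S x hx
    have tf := satAlg_tf R S x hx
    have hfin : Module.Finite R (satAlg R S x hx) := Module.Finite.of_injective f hf
    have hrank : Module.finrank R (satAlg R S x hx) ≤ Module.finrank R S :=
      LinearMap.finrank_le_finrank_of_injective hf
    have hfs : FaithfulSMul S (satAlg R S x hx) := by
      rw [faithfulSMul_iff_algebraMap_injective]
      intro a b h
      exact IsFractionRing.injective S (FractionRing S) (congrArg Subtype.val h)
    have : FaithfulSMul R (satAlg R S x hx) := FaithfulSMul.trans R S _
    refine rk_step (T := satAlg R S x hx) x hx hxm tf hrank ?_ Q hQ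
    intro P hP hPo Q hQ
    exact ih (R ⧸ Ideal.span {x}) (satAlg R S x hx ⧸ P) t hts ht hdt Q hQ


lemma int_dim_le (R : Type u) (S : Type v) [CommRing R] [CommRing S] [Algebra R S]
    [FaithfulSMul R S] [Algebra.IsIntegral R S] : ringKrullDim R ≤ ringKrullDim S := by
  have key : ∀ n : ℕ, ∀ l : LTSeries (PrimeSpectrum R), l.length = n →
      ∃ l' : LTSeries (PrimeSpectrum S), l'.length = n ∧
        PrimeSpectrum.comap (algebraMap R S) l'.last = l.last := by
    intro n
    induction n with
    | zero =>
      intro l hl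
      obtain ⟨Q, _, hQ, hQl⟩ := Ideal.exists_ideal_over_prime_of_isIntegral l.last.asIdeal
        (⊥ : Ideal S) (by
          rw [← RingHom.ker_eq_comap_bot,
            (RingHom.injective_iff_ker_eq_bot _).1 (FaithfulSMul.algebraMap_injective R S)]
          exact bot_le)
      exact ⟨RelSeries.singleton _ ⟨Q, hQ⟩, rfl, PrimeSpectrum.ext hQl⟩
    | succ n ih =>
      intro l hl
      obtain ⟨l', hl', hlast⟩ := ih l.eraseLast (by simp [hl])
      have hlt : l.eraseLast.last < l.last := l.eraseLast_last_rel_last (by omega)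
      obtain ⟨Q, hle, hQ, hQl⟩ := Ideal.exists_ideal_over_prime_of_isIntegral l.last.asIdeal
        l'.last.asIdeal (by
          have : (PrimeSpectrum.comap (algebraMap R S) l'.last).asIdeal ≤ l.last.asIdeal := by
            rw [hlast]; exact hlt.le
          exact this)
      have h2 : PrimeSpectrum.comap (algebraMap R S) ⟨Q, hQ⟩ = l.last := PrimeSpectrum.ext hQl
      have hlt2 : l'.last < (⟨Q, hQ⟩ : PrimeSpectrum S) := by
        refine lt_of_le_of_ne hle ?_
        intro h
        rw [← h, hlast] at h2
        exact hlt.ne h2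
      refine ⟨l'.snoc ⟨Q, hQ⟩ hlt2, ?_, ?_⟩
      · rw [RelSeries.snoc_length, hl']
      · rw [RelSeries.last_snoc]; exact h2
  refine iSup_le fun l => ?_
  obtain ⟨l', hl', _⟩ := key _ l rfl
  rw [← hl']
  exact le_iSup (fun l : LTSeries (PrimeSpectrum S) => ((l.length : ℕ∞) : WithBot ℕ∞)) l'

lemma frac_finrank_eq {A : Type u} {B : Type v} [CommRing A] [IsDomain A] [CommRing B] [IsDomain B]
    [Algebra A B] (hf : Function.Injective (algebraMap A B)) :
    fracFinrank (algebraMap A B) hf = Module.finrank A B := by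
  unfold fracFinrank
  letI := ((algebraMap A B).fracMap hf).toAlgebra
  have : IsScalarTower A (FractionRing A) (FractionRing B) := by
    refine IsScalarTower.of_algebraMap_eq fun a => ?_
    change _ = (algebraMap A B).fracMap hf (algebraMap A _ a)
    unfold RingHom.fracMap
    rw [IsFractionRing.lift_algebraMap]
    rfl
  exact IsFractionRing.finrank_eq A (FractionRing A) B (FractionRing B)

lemma residue_finrank_eq {A : Type u} {B : Type v} [CommRing A] [CommRing B]
    [Algebra A B] (q : Ideal B) (hq : q.IsPrime) :
    residueFinrank A q hq = Module.finrank (A ⧸ q.comap (algebraMap A B)) (B ⧸ q) :=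
  frac_finrank_eq (A := A ⧸ q.comap (algebraMap A B)) (B := B ⧸ q) Ideal.quotientMap_injective

lemma len_ge {A : Type u} {B : Type v} {L : Type v} [CommRing A] [CommRing B]
    [Algebra A B] (q : Ideal B) [q.IsPrime] [CommRing L] [Nontrivial L]
    [Algebra (Localization.AtPrime (q.comap (algebraMap A B))) L] [Algebra A L]
    [IsScalarTower A (Localization.AtPrime (q.comap (algebraMap A B))) L]
    [Module.Finite (Localization.AtPrime (q.comap (algebraMap A B))) L]
    (hm : ∀ r ∈ maximalIdeal (Localization.AtPrime (q.comap (algebraMap A B))),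
      algebraMap (Localization.AtPrime (q.comap (algebraMap A B))) L r = 0)
    (f : (B ⧸ q) →+* L) (hf : Function.Injective f)
    (hcomp : ∀ a, f (Ideal.Quotient.mk q (algebraMap A B a)) = algebraMap A L a) :
    (Module.finrank (A ⧸ q.comap (algebraMap A B)) (B ⧸ q) : ℕ∞) ≤
      Module.length (Localization.AtPrime (q.comap (algebraMap A B))) L := by
  set p := q.comap (algebraMap A B) with hp
  let R := Localization.AtPrime p
  letI : Algebra p.ResidueField L :=
    (Ideal.Quotient.lift (maximalIdeal R) (algebraMap R L) hm).toAlgebra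
  letI : Algebra (A ⧸ p) L := (f.comp (algebraMap (A ⧸ p) (B ⧸ q))).toAlgebra
  have t1 : IsScalarTower R p.ResidueField L := IsScalarTower.of_algebraMap_eq fun r => rfl
  have t2 : IsScalarTower (A ⧸ p) p.ResidueField L := by
    refine IsScalarTower.of_algebraMap_eq fun a => ?_
    obtain ⟨a, rfl⟩ := Ideal.Quotient.mk_surjective a
    change f (Ideal.Quotient.mk q (algebraMap A B a)) = _
    rw [hcomp, IsScalarTower.algebraMap_apply A R L]
    rfl
  have hfin : Module.Finite p.ResidueField L := Module.Finite.of_restrictScalars_finite R _ _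
  have h1 : Module.length R L = Module.length p.ResidueField L :=
    Module.length_eq_of_surjective Ideal.Quotient.mk_surjective
  rw [h1, Module.length_eq_finrank]
  have h2 := IsFractionRing.rank_right_eq (A ⧸ p) (S := p.ResidueField) L
  let φ : (B ⧸ q) →ₗ[A ⧸ p] L :=
    { toFun := f
      map_add' := f.map_add
      map_smul' := fun a b => by
        rw [Algebra.smul_def, Algebra.smul_def, map_mul]; rfl }
  have h3 : Module.rank (A ⧸ p) (B ⧸ q) ≤ Module.rank (A ⧸ p) L :=
    LinearMap.rank_le_of_injective φ hf
  rw [← h2] at h3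
  exact_mod_cast Cardinal.toNat_le_toNat h3 (Module.rank_lt_aleph0 _ _)

lemma regLocal_gens {R : Type u} [CommRing R] (h : IsRegularLocal R) :
    IsNoetherianRing R ∧ ∃ _ : IsLocalRing R, ∃ s : Finset R,
      Ideal.span (s : Set R) = maximalIdeal R ∧ (s.card : WithBot ℕ∞) = ringKrullDim R := by
  obtain ⟨h1, h2, h3⟩ := h
  refine ⟨h1, h2, ?_⟩
  obtain ⟨s, hs, hs2⟩ := Nat.sInf_mem (s := {n : ℕ | ∃ s : Finset R, s.card = n ∧
        Ideal.span (s : Set R) = maximalIdeal R}) (by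
    obtain ⟨s, hs⟩ := (IsNoetherian.noetherian (maximalIdeal R))
    exact ⟨_, s, rfl, hs⟩)
  exact ⟨s, hs2, by rw [hs]; exact h3⟩

lemma regLocal_of_gens {R : Type u} [CommRing R] [IsNoetherianRing R] [IsLocalRing R] (s : Finset R)
    (hs : Ideal.span (s : Set R) = maximalIdeal R) (hd : (s.card : WithBot ℕ∞) ≤ ringKrullDim R) :
    IsRegularLocal R := by
  refine ⟨inferInstance, inferInstance, le_antisymm (le_trans ?_ hd) ?_⟩
  · have h := Nat.sInf_le (s := {n : ℕ | ∃ s : Finset R, s.card = n ∧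
        Ideal.span (s : Set R) = maximalIdeal R}) ⟨s, rfl, hs⟩
    exact_mod_cast h
  · obtain ⟨s, hs, hs2⟩ := Nat.sInf_mem (s := {n : ℕ | ∃ s : Finset R, s.card = n ∧
        Ideal.span (s : Set R) = maximalIdeal R}) ⟨_, s, rfl, hs⟩
    rw [← hs]
    refine (ringKrullDim_le_spanFinrank_maximalIdeal R).trans ?_
    rw [← hs2]
    have := Submodule.spanFinrank_span_le_ncard_of_finite (R := R) s.finite_toSet
    rw [Set.ncard_coe_finset] at this
    exact_mod_cast this

lemma regLocal_congr {R : Type u} {S : Type v} [CommRing R] [CommRing S] (e : R ≃+* S)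
    (h : IsRegularLocal R) : IsRegularLocal S := by
  classical
  obtain ⟨h1, h2, s, hs, hd⟩ := regLocal_gens h
  have := e.isLocalRing
  have := isNoetherianRing_of_ringEquiv R e
  refine regLocal_of_gens (s.image e) ?_ ?_
  · rw [Finset.coe_image, ← IsLocalRing.map_maximalIdeal_of_surjective (e : R →+* S) e.surjective,
      ← hs, Ideal.map_span]; rfl
  · rw [← ringKrullDim_eq_of_ringEquiv e, ← hd]
    exact_mod_cast Finset.card_image_le

end helpers

open IsLocalRing


/-- Let `A ⊆ B` be an extension of integral domains with `B` a finite
`A`-module.  Let `q` be a prime of `B` over `p = q ∩ A`.  If `A_p` is a regular local ring and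
`[K(B) : K(A)] = [κ(q) : κ(p)]` (both finite), then `B_q` is a regular local ring. -/
theorem localization_regular_of_degree_eq
    (A : Type u) (B : Type v) [CommRing A] [IsDomain A] [CommRing B] [IsDomain B]
    [Algebra A B] (hAB : Function.Injective (algebraMap A B))
    [Module.Finite A B]
    (q : Ideal B) (hq : q.IsPrime)
    (hreg : haveI := hq; IsRegularLocal (Localization.AtPrime (q.comap (algebraMap A B))))
    (hKfin : FracFinite (algebraMap A B) hAB)
    (hκfin : ResidueFinite A q hq)
    (hdeg : fracFinrank (algebraMap A B) hAB = residueFinrank A q hq) :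
    haveI := hq; IsRegularLocal (Localization.AtPrime q) := by
  classical
  obtain ⟨hN, _, s, hs, hd⟩ := regLocal_gens hreg
  set p := q.comap (algebraMap A B) with hp
  let M := Algebra.algebraMapSubmonoid B p.primeCompl
  have hMq : M ≤ q.primeCompl := by
    rintro _ ⟨a, ha, rfl⟩
    exact ha
  have hM0 : M ≤ nonZeroDivisors B := hMq.trans q.primeCompl_le_nonZeroDivisors
  let R := Localization.AtPrime p
  let S := Localization M
  have : IsDomain S := IsLocalization.isDomain_localization hM0
  have hfinS : Module.Finite R S := Module.Finite.of_isLocalization A B p.primeCompl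
  have hRS : FaithfulSMul R S := by
    rw [faithfulSMul_iff_algebraMap_injective]
    exact localizationAlgebra_injective (M := p.primeCompl) R S hAB
  have hdis : Disjoint (M : Set B) (q : Set B) := by
    rw [Set.disjoint_left]
    intro x hx; exact hMq hx
  let Q : Ideal S := q.map (algebraMap B S)
  have hQp : Q.IsPrime := IsLocalization.isPrime_of_isPrime_disjoint M S q hq hdis
  have hQq : Q.comap (algebraMap B S) = q := IsLocalization.comap_map_of_isPrime_disjoint M S hq hdis
  have hQover : Q.comap (algebraMap R S) = maximalIdeal R := by
    rw [← IsLocalization.map_under p.primeCompl R (Q.comap (algebraMap R S)),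
      Ideal.under_def, Ideal.comap_comap, ← IsScalarTower.algebraMap_eq A R S,
      IsScalarTower.algebraMap_eq A B S, ← Ideal.comap_comap, hQq, ← hp]
    exact Localization.AtPrime.map_eq_maximalIdeal
  have hint : Algebra.IsIntegral R S := inferInstance
  have hQmax : Q.IsMaximal := by
    refine Ideal.isMaximal_of_isIntegral_of_isMaximal_comap (R := R) Q ?_
    rw [hQover]; infer_instance
  have hrank : Module.finrank R S = Module.finrank A B := by
    rw [Module.finrank, Module.finrank, IsLocalization.rank_eq R p.primeCompl
      p.primeCompl_le_nonZeroDivisors, IsLocalizedModule.rank_eq p.primeCompl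
      p.primeCompl_le_nonZeroDivisors (IsScalarTower.toAlgHom A B S).toLinearMap]
  have hlen : (Module.finrank (A ⧸ p) (B ⧸ q) : ℕ∞) ≤ Module.length R (S ⧸ Q) := by
    refine len_ge q ?_ (Ideal.quotientMap Q (algebraMap B S) hQq.ge)
      (Ideal.quotientMap_injective' (H := hQq.ge) hQq.le) ?_
    · intro r hr
      rw [← hQover] at hr
      exact Ideal.Quotient.eq_zero_iff_mem.2 hr
    · intro a
      rfl
  obtain ⟨-, hmain⟩ := rk_main s.card R S s hs le_rfl hd.le Q hQmax
  have hQeq := hmain (by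
    rw [hrank, ← frac_finrank_eq hAB, hdeg, residue_finrank_eq]
    exact hlen)
  have hlocS : IsLocalRing S := by
    refine IsLocalRing.of_unique_max_ideal ⟨Q, hQmax, fun J hJ => ?_⟩
    have hJm : J.comap (algebraMap R S) = maximalIdeal R :=
      IsLocalRing.eq_maximalIdeal (Ideal.isMaximal_comap_of_isIntegral_of_isMaximal J)
    refine (hQmax.eq_of_le hJ.ne_top ?_).symm
    rw [hQeq, Ideal.map_le_iff_le_comap, hJm]
  have hmS : maximalIdeal S = Q := (IsLocalRing.eq_maximalIdeal hQmax).symm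
  have hNS : IsNoetherianRing S := IsNoetherianRing.of_finite R S
  have hregS : IsRegularLocal S := by
    refine regLocal_of_gens (s.image (algebraMap R S)) ?_ ?_
    · rw [hmS, hQeq, ← hs, Ideal.map_span, Finset.coe_image]
    · refine le_trans ?_ (int_dim_le R S)
      rw [← hd]
      exact_mod_cast Finset.card_image_le
  have hloc : IsLocalization q.primeCompl S := by
    refine IsLocalization.of_le M _ hMq fun b hb => ?_
    by_contra hu
    have : algebraMap B S b ∈ maximalIdeal S := hu
    rw [hmS] at this
    exact hb (hQq.le this)
  exact regLocal_congr (IsLocalization.algEquiv q.primeCompl S (Localization.AtPrime q)).toRingEquiv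
    hregS


end
end

section
/- Let A be a Noetherian integrally closed integral domain which is a Nagata ring, let p be a prime ideal of A, and let C be an integrally closed integral domain containing A/p which is finitely generated as an (A/p)-module. Suppose that either (1) the residue field κ(p) is perfect, or (2) the localization A_p is a regular local ring. Then there exist an integrally closed integral domain B containing A, finitely generated as an A-module, and a prime ideal r of B with r ∩ A = p, together with an injective (A/p)-algebra homomorphism B/r → C compatible with the inclusions A/p ⊆ B/r and A/p ⊆ C, such that C is the integral closure of B/r in its field of fractions (in particular the induced extension K(B/r) → K(C) is an isomorphism) and [K(B) : K(A)] = [K(C) : K(A/p)]. -/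
noncomputable section

open Ideal

universe u v

/-- A domain `R` is *Japanese* if for every finite field extension `L` of its fraction field
`K(R)`, the integral closure of `R` in `L` is a finitely generated `R`-module. -/
def IsJapanese (R : Type u) [CommRing R] [IsDomain R] : Prop :=
  ∀ (L : Type u) [Field L] [Algebra R L] [Algebra (FractionRing R) L]
    [IsScalarTower R (FractionRing R) L] [FiniteDimensional (FractionRing R) L],
    Module.Finite R (integralClosure R L)

/-- A Noetherian commutative ring `A` is a *Nagata ring* if for every prime ideal `P` of `A`,
the domain `A ⧸ P` is Japanese. -/
def IsNagata (A : Type u) [CommRing A] : Prop :=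
  IsNoetherianRing A ∧ ∀ (P : Ideal A) (hP : P.IsPrime), haveI := hP; IsJapanese (A ⧸ P)

open nonZeroDivisors

theorem aux_dvd_of_normal {Q : Type u} [CommRing Q] [IsDomain Q] [IsNoetherianRing Q]
    [IsIntegrallyClosed Q] {b c D : Q} (hb : b ≠ 0) (hD : D ≠ 0)
    (h : ∀ n : ℕ, b ^ n ∣ D * c ^ n) : b ∣ c := by
  let K := FractionRing Q
  have hbK : algebraMap Q K b ≠ 0 := by simpa using hb
  have hintg : IsIntegral Q (algebraMap Q K c / algebraMap Q K b) := by
    apply IsAlmostIntegral.isIntegral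
    refine ⟨D, mem_nonZeroDivisors_of_ne_zero hD, fun n => ?_⟩
    obtain ⟨e, he⟩ := h n
    refine ⟨e, ?_⟩
    rw [Algebra.smul_def, div_pow, ← mul_div_assoc, eq_div_iff (pow_ne_zero _ hbK),
      ← map_pow, ← map_pow, ← map_mul, ← map_mul, he, mul_comm]
  obtain ⟨y, hy⟩ := IsIntegrallyClosed.isIntegral_iff.1 hintg
  refine ⟨y, ?_⟩
  rw [eq_div_iff hbK, ← map_mul] at hy
  rw [mul_comm]; exact (IsFractionRing.injective Q K hy).symm

theorem aux_normal_core {R : Type u} [CommRing R] [IsDomain R] [IsNoetherianRing R] [IsLocalRing R]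
    {x : R} (hx : Prime x) [IsDomain (R ⧸ Ideal.span {x})]
    [IsIntegrallyClosed (R ⧸ Ideal.span {x})]
    {a b D : R} (hxb : ¬ x ∣ b) (hxD : ¬ x ∣ D)
    (h : ∀ n : ℕ, b ^ n ∣ D * a ^ n) : b ∣ a := by
  by_cases hbu : IsUnit b
  · exact hbu.dvd
  have key : ∀ n : ℕ, ∃ r c, a = b * r + x ^ n * c := by
    intro n
    induction n with
    | zero => exact ⟨0, a, by simp⟩
    | succ n ih =>
      obtain ⟨r, c, hrc⟩ := ih
      have h1 : ∀ m : ℕ, b ^ m ∣ D * (x ^ n * c) ^ m := by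
        intro m
        have : x ^ n * c = a + b * (-r) := by rw [hrc]; ring
        rw [this, add_pow, Finset.mul_sum]
        refine Finset.dvd_sum fun i hi => ?_
        obtain ⟨e, he⟩ := h i
        have hi' : i ≤ m := by simpa [Nat.lt_succ_iff] using hi
        have hbm : b ^ m = b ^ i * b ^ (m - i) := by rw [← pow_add]; congr 1; omega
        refine ⟨e * (-r) ^ (m - i) * (m.choose i), ?_⟩
        rw [hbm, mul_pow]
        linear_combination (b ^ (m - i) * (-r) ^ (m - i) * (m.choose i)) * he
      have h2 : ∀ m : ℕ, b ^ m ∣ D * c ^ m := by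
        intro m
        obtain ⟨e, he⟩ := h1 m
        have : (x ^ n) ^ m ∣ b ^ m * e := by
          rw [← he, mul_pow]; exact ⟨D * c ^ m, by ring⟩
        rw [← pow_mul] at this
        obtain ⟨e', rfl⟩ := hx.pow_dvd_of_dvd_mul_left _
          (fun hh => hxb (hx.dvd_of_dvd_pow hh)) this
        refine ⟨e', ?_⟩
        apply mul_left_cancel₀ (pow_ne_zero (n * m) hx.ne_zero)
        rw [mul_pow, ← pow_mul] at he
        linear_combination he
      have hmk : ∀ y : R, Ideal.Quotient.mk (Ideal.span {x}) y = 0 ↔ x ∣ y := by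
        intro y
        rw [Ideal.Quotient.eq_zero_iff_mem, Ideal.mem_span_singleton]
      have h3 := aux_dvd_of_normal (Q := R ⧸ Ideal.span {x})
        (b := Ideal.Quotient.mk _ b) (c := Ideal.Quotient.mk _ c) (D := Ideal.Quotient.mk _ D)
        (fun hh => hxb ((hmk _).1 hh)) (fun hh => hxD ((hmk _).1 hh))
        (fun m => by
          rw [← map_pow, ← map_pow, ← map_mul]
          exact map_dvd _ (h2 m))
      obtain ⟨r', hr'⟩ := h3
      obtain ⟨r', rfl⟩ := Ideal.Quotient.mk_surjective r'
      have : Ideal.Quotient.mk (Ideal.span {x}) (c - b * r') = 0 := by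
        rw [map_sub, map_mul, hr', sub_self]
      obtain ⟨c', hc'⟩ := (hmk _).1 this
      refine ⟨r + x ^ n * r', c', ?_⟩
      rw [hrc]
      linear_combination x ^ n * hc'
  have hnt : Nontrivial (R ⧸ Ideal.span {b}) := by
    rw [Ideal.Quotient.nontrivial_iff, Ne, Ideal.span_singleton_eq_top]
    exact hbu
  have hloc : IsLocalRing (R ⧸ Ideal.span {b}) :=
    IsLocalRing.of_surjective' (Ideal.Quotient.mk (Ideal.span {b})) Ideal.Quotient.mk_surjective
  have hbot := Ideal.iInf_pow_eq_bot_of_isLocalRing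
    (IsLocalRing.maximalIdeal (R ⧸ Ideal.span {b})) (Ideal.IsPrime.ne_top inferInstance)
  have hxm : Ideal.Quotient.mk (Ideal.span {b}) x ∈ IsLocalRing.maximalIdeal _ := by
    rw [IsLocalRing.mem_maximalIdeal, mem_nonunits_iff]
    intro hu
    haveI := IsLocalHom.of_surjective (Ideal.Quotient.mk (Ideal.span {b}))
      Ideal.Quotient.mk_surjective
    have := (isUnit_map_iff (Ideal.Quotient.mk (Ideal.span {b})) x).1 hu
    exact hx.not_unit this
  have : Ideal.Quotient.mk (Ideal.span {b}) a ∈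
      (⨅ i : ℕ, IsLocalRing.maximalIdeal (R ⧸ Ideal.span {b}) ^ i) := by
    rw [Ideal.mem_iInf]
    intro n
    obtain ⟨r, c, hrc⟩ := key n
    have hb0 : Ideal.Quotient.mk (Ideal.span {b}) b = 0 := by
      rw [Ideal.Quotient.eq_zero_iff_mem]; exact Ideal.mem_span_singleton_self b
    rw [hrc, map_add, map_mul, hb0, zero_mul, zero_add, map_mul, map_pow]
    exact Ideal.mul_mem_right _ _ (Ideal.pow_mem_pow hxm n)
  rw [hbot, Ideal.mem_bot, Ideal.Quotient.eq_zero_iff_mem, Ideal.mem_span_singleton] at this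
  exact this

theorem aux_normal_lift {R : Type u} [CommRing R] [IsDomain R] [IsNoetherianRing R] [IsLocalRing R]
    {x : R} (hx : Prime x) [IsDomain (R ⧸ Ideal.span {x})]
    [IsIntegrallyClosed (R ⧸ Ideal.span {x})] : IsIntegrallyClosed R := by
  have step1 : ∀ {a b D : R}, ¬ x ∣ b → D ≠ 0 → (∀ n : ℕ, b ^ n ∣ D * a ^ n) → b ∣ a := by
    intro a b D hxb hD h
    obtain ⟨s, D', hD', rfl⟩ := WfDvdMonoid.max_power_factor hD hx.irreducible
    refine aux_normal_core hx hxb hD' fun n => ?_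
    obtain ⟨e, he⟩ := h n
    have : x ^ s ∣ b ^ n * e := ⟨D' * a ^ n, by rw [← he]; ring⟩
    obtain ⟨e', rfl⟩ := hx.pow_dvd_of_dvd_mul_left _
      (fun hh => hxb (hx.dvd_of_dvd_pow hh)) this
    refine ⟨e', ?_⟩
    apply mul_left_cancel₀ (pow_ne_zero s hx.ne_zero)
    linear_combination he
  have step2 : ∀ (j : ℕ) {a b D : R}, ¬ x ∣ b → D ≠ 0 →
      (∀ n : ℕ, (x ^ j * b) ^ n ∣ D * a ^ n) → x ^ j * b ∣ a := by
    intro j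
    induction j with
    | zero => intro a b D hxb hD h; simp only [pow_zero, one_mul] at h ⊢; exact step1 hxb hD h
    | succ j ih =>
      intro a b D hxb hD h
      have hxa : x ∣ a := by
        by_contra hxa
        obtain ⟨s, D', hD', rfl⟩ := WfDvdMonoid.max_power_factor hD hx.irreducible
        have h1 : x ^ (s + 1) ∣ (x ^ s * D') * a ^ (s + 1) :=
          dvd_trans ⟨(x ^ j * b) ^ (s + 1), by ring⟩ (h (s + 1))
        have h2 := hx.pow_dvd_of_dvd_mul_right _ (fun hh => hxa (hx.dvd_of_dvd_pow hh)) h1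
        rw [pow_succ] at h2
        exact hD' ((mul_dvd_mul_iff_left (pow_ne_zero s hx.ne_zero)).1 h2)
      obtain ⟨a', rfl⟩ := hxa
      have := ih (a := a') hxb hD (fun n => by
        have h1 := h n
        have e1 : (x ^ (j + 1) * b) ^ n = x ^ n * (x ^ j * b) ^ n := by
          rw [← mul_pow]; ring
        have e2 : D * (x * a') ^ n = x ^ n * (D * a' ^ n) := by ring
        rw [e1, e2] at h1
        exact (mul_dvd_mul_iff_left (pow_ne_zero n hx.ne_zero)).1 h1)
      have e : x ^ (j + 1) * b = x * (x ^ j * b) := by ring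
      rw [e]
      exact mul_dvd_mul_left x this
  rw [isIntegrallyClosed_iff (FractionRing R)]
  intro z hz
  obtain ⟨D, hD, hDn⟩ := hz.isAlmostIntegral
  obtain ⟨a, b, hb, rfl⟩ := IsFractionRing.div_surjective (A := R) z
  have hb0 : b ≠ 0 := nonZeroDivisors.ne_zero hb
  have hbK : algebraMap R (FractionRing R) b ≠ 0 := by simpa using hb0
  have hall : ∀ n : ℕ, b ^ n ∣ D * a ^ n := by
    intro n
    obtain ⟨e, he⟩ := hDn n
    rw [Algebra.smul_def, div_pow, ← mul_div_assoc, eq_div_iff (pow_ne_zero _ hbK),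
      ← map_pow, ← map_pow, ← map_mul, ← map_mul] at he
    exact ⟨e, by rw [← IsFractionRing.injective R (FractionRing R) he, mul_comm]⟩
  have hba : b ∣ a := by
    obtain ⟨j, b', hb', rfl⟩ := WfDvdMonoid.max_power_factor hb0 hx.irreducible
    exact step2 j hb' (nonZeroDivisors.ne_zero hD) hall
  obtain ⟨y, rfl⟩ := hba
  exact ⟨y, by rw [map_mul, mul_div_cancel_left₀ _ hbK]⟩

theorem aux_generators {R : Type u} [CommRing R] [IsLocalRing R] (s : Finset R)
    (hs : Ideal.span (s : Set R) = IsLocalRing.maximalIdeal R) {x : R}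
    (hx : x ∈ IsLocalRing.maximalIdeal R) (hx2 : x ∉ IsLocalRing.maximalIdeal R ^ 2) :
    ∃ t : Finset R, t.card + 1 = s.card ∧
      Ideal.span (insert x (t : Set R)) = IsLocalRing.maximalIdeal R := by
  classical
  have hx' := hx
  rw [← hs] at hx'
  obtain ⟨c, hc, hcx⟩ := Submodule.mem_span_finset.1 hx'
  have hex : ∃ y ∈ s, IsUnit (c y) := by
    by_contra! hcon
    apply hx2
    rw [← hcx]
    refine Ideal.sum_mem _ fun y hy => ?_
    rw [smul_eq_mul, pow_two]
    refine Ideal.mul_mem_mul ?_ ?_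
    · exact (IsLocalRing.mem_maximalIdeal _).2 (hcon y hy)
    · rw [← hs]; exact Ideal.subset_span hy
  obtain ⟨y, hy, hu⟩ := hex
  refine ⟨s.erase y, Finset.card_erase_add_one hy, ?_⟩
  apply le_antisymm
  · rw [Ideal.span_le]
    intro z hz
    rcases hz with rfl | hz
    · exact hx
    · rw [SetLike.mem_coe, ← hs]
      exact Ideal.subset_span (Finset.mem_of_mem_erase hz)
  · rw [← hs, Ideal.span_le]
    intro z hz
    by_cases hzy : z = y
    · subst hzy
      rw [SetLike.mem_coe, ← Ideal.unit_mul_mem_iff_mem _ hu]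
      have e : c z * z = x - ∑ w ∈ s.erase z, c w • w := by
        rw [← hcx, ← Finset.add_sum_erase s _ hy, smul_eq_mul]; ring
      rw [e]
      refine Ideal.sub_mem _ (Ideal.subset_span (Set.mem_insert _ _)) (Ideal.sum_mem _ fun w hw => ?_)
      exact Ideal.mul_mem_left _ _ (Ideal.subset_span (Set.mem_insert_of_mem _ hw))
    · exact Ideal.subset_span (Set.mem_insert_of_mem _ (Finset.mem_erase.2 ⟨hzy, hz⟩))

theorem aux_regular (d : ℕ) : ∀ (R : Type u) [CommRing R] [IsNoetherianRing R] [IsLocalRing R],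
    (d : WithBot ℕ∞) ≤ ringKrullDim R →
    (∃ s : Finset R, s.card ≤ d ∧ Ideal.span (s : Set R) = IsLocalRing.maximalIdeal R) →
    IsDomain R ∧ IsIntegrallyClosed R := by
  classical
  induction d with
  | zero =>
    intro R _ _ _ _ ⟨s, hs, hsm⟩
    have : s = ∅ := by simpa using hs
    subst this
    have hf : IsField R := by
      rw [IsLocalRing.isField_iff_maximalIdeal_eq, ← hsm]; simp
    letI := hf.toField
    exact ⟨hf.isDomain, inferInstance⟩
  | succ d ih =>
    intro R _ _ _ hdim ⟨s, hs, hsm⟩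
    have hdim0 : ringKrullDim R ≠ 0 := by
      intro h0
      rw [h0] at hdim
      have : ((d + 1 : ℕ) : WithBot ℕ∞) ≤ ((0 : ℕ) : WithBot ℕ∞) := by simpa using hdim
      have := Nat.cast_le.1 this
      omega
    have hsq := IsLocalRing.maximalIdeal_sq_lt_of_ringKrullDim_ne_zero hdim0
    have hav : ∃ x ∈ IsLocalRing.maximalIdeal R, x ∉ IsLocalRing.maximalIdeal R ^ 2 ∧
        ∀ q ∈ minimalPrimes R, x ∉ q := by
      by_contra! hcon
      have h1 : ((IsLocalRing.maximalIdeal R : Ideal R) : Set R) ⊆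
          ⋃ i ∈ insert (IsLocalRing.maximalIdeal R ^ 2) (minimalPrimes R), ((id i : Ideal R) : Set R) := by
        intro x hx
        by_cases h2 : x ∈ IsLocalRing.maximalIdeal R ^ 2
        · exact Set.mem_biUnion (Set.mem_insert _ _) h2
        · obtain ⟨q, hq, hxq⟩ := hcon x hx h2
          exact Set.mem_biUnion (Set.mem_insert_of_mem _ hq) hxq
      rw [Ideal.subset_union_prime_finite
        ((minimalPrimes.finite_of_isNoetherianRing R).insert _)
        (IsLocalRing.maximalIdeal R ^ 2) (IsLocalRing.maximalIdeal R ^ 2)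
        (fun i hi h1 _ => by
          rcases hi with rfl | hi
          · exact absurd rfl h1
          · exact hi.1.1)] at h1
      obtain ⟨q, hq, hle⟩ := h1
      rcases hq with rfl | hq
      · exact absurd hle hsq.not_ge
      · have : q.IsPrime := hq.1.1
        have heq : q = IsLocalRing.maximalIdeal R :=
          le_antisymm (IsLocalRing.le_maximalIdeal this.ne_top) hle
        apply hdim0
        rw [← IsLocalRing.maximalIdeal_height_eq_ringKrullDim, ← heq]
        have : q.height = 0 := Ideal.height_eq_zero_iff.2 hq
        rw [this]; rfl
    obtain ⟨x, hxm, hx2, hxq⟩ := hav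
    obtain ⟨t, htc, htm⟩ := aux_generators s hsm hxm hx2
    have hnt : Nontrivial (R ⧸ Ideal.span {x}) := by
      rw [Ideal.Quotient.nontrivial_iff, Ne, Ideal.span_singleton_eq_top]
      exact (IsLocalRing.mem_maximalIdeal _).1 hxm
    have hloc : IsLocalRing (R ⧸ Ideal.span {x}) :=
      IsLocalRing.of_surjective' (Ideal.Quotient.mk (Ideal.span {x})) Ideal.Quotient.mk_surjective
    have hx0 : Ideal.Quotient.mk (Ideal.span {x}) x = 0 := by
      rw [Ideal.Quotient.eq_zero_iff_mem]; exact Ideal.mem_span_singleton_self x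
    have hdimQ : (d : WithBot ℕ∞) ≤ ringKrullDim (R ⧸ Ideal.span {x}) := by
      have h1 := Ideal.height_le_ringKrullDim_quotient_add_one hxm
      rw [IsLocalRing.maximalIdeal_height_eq_ringKrullDim] at h1
      have h2 := hdim.trans h1
      push_cast at h2
      exact ENat.WithBot.add_le_add_one_right_iff.1 h2
    obtain ⟨hD, hN⟩ := ih (R ⧸ Ideal.span {x}) hdimQ
      ⟨t.image (Ideal.Quotient.mk (Ideal.span {x})), Finset.card_image_le.trans (by omega), by
        rw [← IsLocalRing.map_maximalIdeal_of_surjective (Ideal.Quotient.mk (Ideal.span {x}))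
          Ideal.Quotient.mk_surjective, ← htm, Ideal.map_span, Set.image_insert_eq, hx0,
          Ideal.span_insert_zero, Finset.coe_image]⟩
    have hprime : (Ideal.span {x}).IsPrime := (Ideal.Quotient.isDomain_iff_prime _).1 hD
    obtain ⟨q, hq, hqx⟩ := Ideal.exists_minimalPrimes_le (I := (⊥ : Ideal R)) (J := Ideal.span {x})
      bot_le
    have hqp : q.IsPrime := hq.1.1
    have hxq' : x ∉ q := hxq q hq
    have hq0 : q = ⊥ := by
      apply Submodule.eq_bot_of_le_smul_of_le_jacobson_bot (Ideal.span {x}) q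
        (IsNoetherian.noetherian _)
      · intro y hy
        obtain ⟨z, rfl⟩ := Ideal.mem_span_singleton.1 (hqx hy)
        rw [smul_eq_mul]
        exact Ideal.mul_mem_mul (Ideal.mem_span_singleton_self x)
          ((hqp.mem_or_mem hy).resolve_left hxq')
      · rw [IsLocalRing.jacobson_eq_maximalIdeal _ bot_ne_top, Ideal.span_singleton_le_iff_mem]
        exact hxm
    have hdom : IsDomain R := by
      subst hq0
      haveI := hqp
      exact IsDomain.of_bot_isPrime R
    refine ⟨hdom, ?_⟩
    have hxne : x ≠ 0 := by
      rintro rfl; exact hxq' q.zero_mem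
    exact aux_normal_lift ((Ideal.span_singleton_prime hxne).1 hprime)

theorem aux_local {S E : Type u} [CommRing S] [IsLocalRing S] [Field E] (ψ : S →+* E)
    (hψ : Function.Surjective ψ) (f : Polynomial S) (hf : f.Monic)
    (hirr : Irreducible (f.map ψ)) :
    ∃ h : IsLocalRing (AdjoinRoot f), @IsLocalRing.maximalIdeal _ _ h =
      (IsLocalRing.maximalIdeal S).map (algebraMap S (AdjoinRoot f)) := by
  haveI : Module.Finite S (AdjoinRoot f) := hf.finite_adjoinRoot
  have hker : RingHom.ker ψ = IsLocalRing.maximalIdeal S :=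
    IsLocalRing.eq_maximalIdeal (RingHom.ker_isMaximal_of_surjective ψ hψ)
  haveI : Fact (Irreducible (f.map ψ)) := ⟨hirr⟩
  let Φ : AdjoinRoot f →+* AdjoinRoot (f.map ψ) :=
    AdjoinRoot.lift ((AdjoinRoot.of (f.map ψ)).comp ψ) (AdjoinRoot.root (f.map ψ)) (by
      rw [← Polynomial.eval₂_map, AdjoinRoot.eval₂_root])
  have hΦ : ∀ p : Polynomial S, Φ (AdjoinRoot.mk f p) = AdjoinRoot.mk (f.map ψ) (p.map ψ) := by
    intro p
    simp only [Φ, AdjoinRoot.lift_mk]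
    rw [← Polynomial.eval₂_map, ← AdjoinRoot.aeval_eq]
    rfl
  have hΦs : Function.Surjective Φ := by
    intro y
    obtain ⟨y, rfl⟩ := AdjoinRoot.mk_surjective y
    obtain ⟨p, rfl⟩ := Polynomial.map_surjective ψ hψ y
    exact ⟨_, hΦ p⟩
  have hkerΦ : RingHom.ker Φ = (IsLocalRing.maximalIdeal S).map (algebraMap S (AdjoinRoot f)) := by
    apply le_antisymm
    · intro y hy
      obtain ⟨p, rfl⟩ := AdjoinRoot.mk_surjective y
      rw [RingHom.mem_ker, hΦ, AdjoinRoot.mk_eq_zero] at hy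
      obtain ⟨q, hq⟩ := hy
      obtain ⟨q, rfl⟩ := Polynomial.map_surjective ψ hψ q
      have h1 : p - f * q ∈ (IsLocalRing.maximalIdeal S).map (Polynomial.C) := by
        rw [Ideal.mem_map_C_iff]
        intro n
        rw [← hker, RingHom.mem_ker, ← Polynomial.coeff_map, Polynomial.map_sub,
          Polynomial.map_mul, hq, sub_self, Polynomial.coeff_zero]
      have h2 := Ideal.mem_map_of_mem (AdjoinRoot.mk f) h1
      rw [Ideal.map_map, map_sub, map_mul, AdjoinRoot.mk_self, zero_mul, sub_zero] at h2
      exact h2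
    · rw [Ideal.map_le_iff_le_comap]
      intro y hy
      rw [Ideal.mem_comap, RingHom.mem_ker]
      have : algebraMap S (AdjoinRoot f) y = AdjoinRoot.mk f (Polynomial.C y) := rfl
      rw [← hker, RingHom.mem_ker] at hy
      rw [this, hΦ, Polynomial.map_C, hy, map_zero, map_zero]
  have hmax : (RingHom.ker Φ).IsMaximal := RingHom.ker_isMaximal_of_surjective Φ hΦs
  have h : IsLocalRing (AdjoinRoot f) := by
    refine IsLocalRing.of_unique_max_ideal ⟨RingHom.ker Φ, hmax, ?_⟩
    intro M hM
    have hM' : M.IsMaximal := hM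
    have h1 : (M.comap (algebraMap S (AdjoinRoot f))).IsMaximal :=
      Ideal.isMaximal_comap_of_isIntegral_of_isMaximal M
    have h2 := IsLocalRing.eq_maximalIdeal h1
    symm
    apply hmax.eq_of_le hM'.ne_top
    rw [hkerΦ, ← h2]
    exact Ideal.map_comap_le
  exact ⟨h, by rw [← hkerΦ]; exact (IsLocalRing.eq_maximalIdeal hmax).symm⟩

open Polynomial in
theorem aux_case1 {R k l : Type u} [CommRing R] [IsDomain R] [IsLocalRing R]
    [IsIntegrallyClosed R] [Field k] [Field l] [Algebra k l] [FiniteDimensional k l]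
    [Algebra.IsSeparable k l] (π : R →+* k) (hπ : Function.Surjective π) :
    ∃ (S : Type u) (_ : CommRing S) (_ : IsDomain S) (_ : IsIntegrallyClosed S) (_ : Algebra R S)
      (_ : Module.Free R S) (_ : Module.Finite R S) (φ : S →+* l),
      Function.Surjective φ ∧ φ.comp (algebraMap R S) = (algebraMap k l).comp π ∧
      Module.finrank R S = Module.finrank k l := by
  obtain ⟨α, hα⟩ := Field.exists_primitive_element k l
  have hαi : IsIntegral k α := Algebra.IsIntegral.isIntegral α
  obtain ⟨f, hfmap, hfdeg, hf⟩ := lifts_and_natDegree_eq_and_monic (f := π)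
    (p := minpoly k α) (by
      obtain ⟨q, hq⟩ := Polynomial.map_surjective π hπ (minpoly k α)
      exact (Polynomial.mem_lifts _).2 ⟨q, hq⟩) (minpoly.monic hαi)
  have hirrk : Irreducible (f.map π) := by rw [hfmap]; exact minpoly.irreducible hαi
  obtain ⟨hloc, -⟩ := aux_local π hπ f hf hirrk
  let K := FractionRing R
  have hirrR : Irreducible f := hf.irreducible_of_irreducible_map π f hirrk
  have hirr : Irreducible (f.map (algebraMap R K)) :=
    (hf.irreducible_iff_irreducible_map_fraction_map).1 hirrR
  haveI : Fact (Irreducible (f.map (algebraMap R K))) := ⟨hirr⟩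
  let j : AdjoinRoot f →+* AdjoinRoot (f.map (algebraMap R K)) :=
    AdjoinRoot.map (algebraMap R K) f _ dvd_rfl
  have hjmk : ∀ q : R[X], j (AdjoinRoot.mk f q) = AdjoinRoot.mk _ (q.map (algebraMap R K)) := by
    intro q
    simp only [j, AdjoinRoot.map, AdjoinRoot.lift_mk]
    rw [← Polynomial.eval₂_map, ← AdjoinRoot.aeval_eq]
    rfl
  have hinjR : Function.Injective (algebraMap R K) := IsFractionRing.injective R K
  have hj : Function.Injective j := by
    rw [injective_iff_map_eq_zero]
    intro y hy
    obtain ⟨q, rfl⟩ := AdjoinRoot.mk_surjective y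
    rw [hjmk, AdjoinRoot.mk_eq_zero, Polynomial.map_dvd_map _ hinjR hf] at hy
    exact AdjoinRoot.mk_eq_zero.2 hy
  have hdom : IsDomain (AdjoinRoot f) := hj.isDomain j
  haveI : Module.Finite R (AdjoinRoot f) := hf.finite_adjoinRoot
  haveI : Module.Free R (AdjoinRoot f) := hf.free_adjoinRoot
  let φ : AdjoinRoot f →+* l := AdjoinRoot.lift ((algebraMap k l).comp π) α (by
    rw [← Polynomial.eval₂_map, hfmap]; exact minpoly.aeval k α)
  have hφmk : ∀ q : R[X], φ (AdjoinRoot.mk f q) = aeval α (q.map π) := by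
    intro q
    simp only [φ, AdjoinRoot.lift_mk]
    rw [← Polynomial.eval₂_map]; rfl
  have hφs : Function.Surjective φ := by
    intro z
    have h1 : z ∈ Algebra.adjoin k {α} := by
      rw [(IntermediateField.adjoin_simple_eq_top_iff_of_isAlgebraic hαi.isAlgebraic).1 hα]
      trivial
    rw [Algebra.adjoin_singleton_eq_range_aeval] at h1
    obtain ⟨q, rfl⟩ := h1
    obtain ⟨q, rfl⟩ := Polynomial.map_surjective π hπ q
    exact ⟨_, hφmk q⟩
  have hder : IsUnit (AdjoinRoot.mk f (derivative f)) := by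
    haveI := IsLocalHom.of_surjective φ hφs
    rw [← isUnit_map_iff φ, hφmk, ← Polynomial.derivative_map, hfmap]
    exact ((Algebra.IsSeparable.isSeparable k α).aeval_derivative_ne_zero
      (minpoly.aeval k α)).isUnit
  have hic : IsIntegrallyClosed (AdjoinRoot f) := by
    letI : Algebra (AdjoinRoot f) (AdjoinRoot (f.map (algebraMap R K))) := j.toAlgebra
    haveI : FaithfulSMul (AdjoinRoot f) (AdjoinRoot (f.map (algebraMap R K))) :=
      (faithfulSMul_iff_algebraMap_injective _ _).2 hj
    haveI : IsScalarTower R (AdjoinRoot f) (AdjoinRoot (f.map (algebraMap R K))) := by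
      refine IsScalarTower.of_algebraMap_eq fun x => ?_
      change _ = j (AdjoinRoot.mk f (C x))
      rw [hjmk, Polynomial.map_C]
      rfl
    haveI : IsFractionRing (AdjoinRoot f) (AdjoinRoot (f.map (algebraMap R K))) := by
      refine IsFractionRing.of_field _ _ fun z => ?_
      obtain ⟨q, rfl⟩ := AdjoinRoot.mk_surjective z
      obtain ⟨b, hb, hbq⟩ := IsLocalization.integerNormalization_spec R⁰ q
      refine ⟨AdjoinRoot.mk f (IsLocalization.integerNormalization R⁰ q),
        AdjoinRoot.mk f (C b), ?_⟩
      have hbne : j (AdjoinRoot.mk f (C b)) ≠ 0 := by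
        rw [Ne, map_eq_zero_iff j hj, AdjoinRoot.mk_eq_zero]
        intro hdvd
        have hb0 : b ≠ 0 := nonZeroDivisors.ne_zero hb
        have := Polynomial.degree_le_of_dvd hdvd (by simpa using hb0)
        rw [Polynomial.degree_C hb0] at this
        have h0 := Polynomial.natDegree_eq_zero_iff_degree_le_zero.2 this
        exact hirrR.not_isUnit ((hf.natDegree_eq_zero.1 h0).symm ▸ isUnit_one)
      change _ = j _ / j _
      rw [eq_div_iff hbne, hjmk, hjmk, hbq, Polynomial.map_C, ← map_mul, mul_comm,
        ← Polynomial.smul_eq_C_mul, algebraMap_smul]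
    rw [isIntegrallyClosed_iff (AdjoinRoot (f.map (algebraMap R K)))]
    intro y hy
    have hyR : IsIntegral R y := isIntegral_trans (R := R) y hy
    let ψ : K[X] →ₐ[R] AdjoinRoot (f.map (algebraMap R K)) :=
      (AdjoinRoot.mkₐ (f.map (algebraMap R K))).restrictScalars R
    obtain ⟨g, hg, hgi⟩ := exists_derivative_mul_eq_and_isIntegral_coeff (R := R) (φ := ψ)
      AdjoinRoot.mk_surjective (hf.map (algebraMap R K))
      (fun i => by rw [Polynomial.coeff_map]; exact isIntegral_algebraMap)
      (by
        ext q
        rw [Ideal.mem_span_singleton, ← AdjoinRoot.mk_eq_zero]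
        rfl) hyR
    obtain ⟨g, rfl⟩ : ∃ g' : R[X], g'.map (algebraMap R K) = g := by
      rw [← Polynomial.mem_lifts, Polynomial.lifts_iff_coeff_lifts]
      intro n
      exact IsIntegrallyClosed.algebraMap_eq_of_integral (hgi n)
    have hg' : j (AdjoinRoot.mk f (derivative f)) * y = j (AdjoinRoot.mk f g) := by
      rw [hjmk, hjmk, ← Polynomial.derivative_map]; exact hg
    obtain ⟨u, hu⟩ := hder
    refine ⟨(↑u⁻¹ : AdjoinRoot f) * AdjoinRoot.mk f g, ?_⟩
    change j _ = y
    rw [map_mul, ← hg', ← mul_assoc, ← hu, ← map_mul, Units.inv_mul, map_one, one_mul]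
  refine ⟨AdjoinRoot f, inferInstance, hdom, hic, inferInstance, inferInstance, inferInstance,
    φ, hφs, ?_, ?_⟩
  · ext x
    change φ (AdjoinRoot.mk f (C x)) = _
    rw [hφmk, Polynomial.map_C, aeval_C]
    rfl
  · rw [(AdjoinRoot.powerBasis' hf).finrank, AdjoinRoot.powerBasis'_dim, hfdeg]
    exact (Field.primitive_element_iff_minpoly_natDegree_eq k α).1 hα

open Polynomial in
theorem aux_step {S E E' : Type u} [CommRing S] [IsNoetherianRing S] [IsLocalRing S]
    [Field E] [Field E'] [Algebra E E'] [FiniteDimensional E E']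
    (ψ : S →+* E) (hψ : Function.Surjective ψ) (x : E') (hx : IntermediateField.adjoin E {x} = ⊤)
    (d : ℕ) (hd : (d : WithBot ℕ∞) ≤ ringKrullDim S)
    (hs : ∃ s : Finset S, s.card ≤ d ∧ Ideal.span (s : Set S) = IsLocalRing.maximalIdeal S) :
    ∃ (S' : Type u) (_ : CommRing S') (_ : IsNoetherianRing S') (_ : IsLocalRing S')
      (_ : Algebra S S') (_ : Module.Free S S') (_ : Module.Finite S S') (φ : S' →+* E'),
      Function.Surjective φ ∧ φ.comp (algebraMap S S') = (algebraMap E E').comp ψ ∧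
      Module.finrank S S' = Module.finrank E E' ∧ (d : WithBot ℕ∞) ≤ ringKrullDim S' ∧
      ∃ s : Finset S', s.card ≤ d ∧ Ideal.span (s : Set S') = IsLocalRing.maximalIdeal S' := by
  classical
  have hαi : IsIntegral E x := Algebra.IsIntegral.isIntegral x
  obtain ⟨f, hfmap, hfdeg, hf⟩ := lifts_and_natDegree_eq_and_monic (f := ψ)
    (p := minpoly E x) (by
      obtain ⟨q, hq⟩ := Polynomial.map_surjective ψ hψ (minpoly E x)
      exact (Polynomial.mem_lifts _).2 ⟨q, hq⟩) (minpoly.monic hαi)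
  have hirrk : Irreducible (f.map ψ) := by rw [hfmap]; exact minpoly.irreducible hαi
  obtain ⟨hloc, hmax⟩ := aux_local ψ hψ f hf hirrk
  haveI : Module.Finite S (AdjoinRoot f) := hf.finite_adjoinRoot
  haveI : Module.Free S (AdjoinRoot f) := hf.free_adjoinRoot
  haveI : IsNoetherianRing (AdjoinRoot f) := IsNoetherianRing.of_finite S _
  let φ : AdjoinRoot f →+* E' := AdjoinRoot.lift ((algebraMap E E').comp ψ) x (by
    rw [← Polynomial.eval₂_map, hfmap]; exact minpoly.aeval E x)
  have hφmk : ∀ q : S[X], φ (AdjoinRoot.mk f q) = aeval x (q.map ψ) := by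
    intro q
    simp only [φ, AdjoinRoot.lift_mk]
    rw [← Polynomial.eval₂_map]; rfl
  have hφs : Function.Surjective φ := by
    intro z
    have h1 : z ∈ Algebra.adjoin E {x} := by
      rw [(IntermediateField.adjoin_simple_eq_top_iff_of_isAlgebraic hαi.isAlgebraic).1 hx]
      trivial
    rw [Algebra.adjoin_singleton_eq_range_aeval] at h1
    obtain ⟨q, rfl⟩ := h1
    obtain ⟨q, rfl⟩ := Polynomial.map_surjective ψ hψ q
    exact ⟨_, hφmk q⟩
  refine ⟨AdjoinRoot f, inferInstance, inferInstance, hloc, inferInstance, inferInstance,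
    inferInstance, φ, hφs, ?_, ?_, ?_, ?_⟩
  · ext x
    change φ (AdjoinRoot.mk f (C x)) = _
    rw [hφmk, Polynomial.map_C, aeval_C]
    rfl
  · rw [(AdjoinRoot.powerBasis' hf).finrank, AdjoinRoot.powerBasis'_dim, hfdeg]
    exact (Field.primitive_element_iff_minpoly_natDegree_eq E x).1 hx
  · refine hd.trans ?_
    rw [← IsLocalRing.maximalIdeal_height_eq_ringKrullDim,
      ← IsLocalRing.maximalIdeal_height_eq_ringKrullDim]
    haveI : (IsLocalRing.maximalIdeal (AdjoinRoot f)).LiesOver (IsLocalRing.maximalIdeal S) := by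
      constructor
      symm
      apply IsLocalRing.eq_maximalIdeal
      exact Ideal.isMaximal_comap_of_isIntegral_of_isMaximal _
    have := Ideal.height_eq_height_add_of_liesOver_of_hasGoingDown
      (IsLocalRing.maximalIdeal S) (IsLocalRing.maximalIdeal (AdjoinRoot f))
    rw [this]
    exact_mod_cast le_self_add
  · obtain ⟨s, hsc, hsm⟩ := hs
    refine ⟨s.image (algebraMap S (AdjoinRoot f)), Finset.card_image_le.trans hsc, ?_⟩
    rw [hmax, ← hsm, Ideal.map_span, Finset.coe_image]

theorem aux_tower {R k l : Type u} [CommRing R] [IsNoetherianRing R] [IsLocalRing R]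
    [Field k] [Field l] [Algebra k l] [FiniteDimensional k l]
    (π : R →+* k) (hπ : Function.Surjective π)
    (d : ℕ) (hd : (d : WithBot ℕ∞) ≤ ringKrullDim R)
    (hs : ∃ s : Finset R, s.card ≤ d ∧ Ideal.span (s : Set R) = IsLocalRing.maximalIdeal R)
    (E : IntermediateField k l) :
    ∃ (S : Type u) (_ : CommRing S) (_ : IsNoetherianRing S) (_ : IsLocalRing S)
      (_ : Algebra R S) (_ : Module.Free R S) (_ : Module.Finite R S) (φ : S →+* E),
      Function.Surjective φ ∧ φ.comp (algebraMap R S) = (algebraMap k E).comp π ∧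
      Module.finrank R S = Module.finrank k E ∧ (d : WithBot ℕ∞) ≤ ringKrullDim S ∧
      ∃ s : Finset S, s.card ≤ d ∧ Ideal.span (s : Set S) = IsLocalRing.maximalIdeal S := by
  induction E using IntermediateField.induction_on_adjoin with
  | base =>
    refine ⟨R, inferInstance, inferInstance, inferInstance, inferInstance, inferInstance,
      inferInstance, (algebraMap k (⊥ : IntermediateField k l)).comp π, ?_, rfl, ?_, hd, hs⟩
    · rw [RingHom.coe_comp]
      refine Function.Surjective.comp ?_ hπ
      rintro ⟨z, hz⟩
      obtain ⟨y, rfl⟩ := IntermediateField.mem_bot.1 hz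
      exact ⟨y, rfl⟩
    · rw [Module.finrank_self, IntermediateField.finrank_bot]
  | ih E x hE =>
    obtain ⟨S, _, _, _, _, _, _, φ, hφ, hcomp, hrk, hdim, hgen⟩ := hE
    obtain ⟨S', _, _, _, _, _, _, φ', hφ', hcomp', hrk', hdim', hgen'⟩ :=
      aux_step (E' := IntermediateField.adjoin E {x}) φ hφ
        (IntermediateField.AdjoinSimple.gen E x) (by
          rw [Field.primitive_element_iff_minpoly_natDegree_eq,
            IntermediateField.minpoly_gen,
            IntermediateField.adjoin.finrank (Algebra.IsIntegral.isIntegral x)])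
        d hdim hgen
    letI : Algebra R S' := ((algebraMap S S').comp (algebraMap R S)).toAlgebra
    haveI : IsScalarTower R S S' := IsScalarTower.of_algebraMap_eq fun x => rfl
    refine ⟨S', inferInstance, inferInstance, inferInstance, inferInstance,
      Module.Free.trans (S := S), Module.Finite.trans S S', φ', hφ', ?_, ?_, hdim', hgen'⟩
    · ext y
      have h1 := RingHom.congr_fun hcomp' (algebraMap R S y)
      have h2 := RingHom.congr_fun hcomp y
      simp only [RingHom.comp_apply] at h1 h2
      rw [h2] at h1
      exact congrArg _ h1
    · rw [← Module.finrank_mul_finrank R S S', hrk, hrk']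
      exact Module.finrank_mul_finrank k E (IntermediateField.adjoin E {x})

theorem aux_case2 {R k l : Type u} [CommRing R] [IsNoetherianRing R] [IsLocalRing R]
    [Field k] [Field l] [Algebra k l] [FiniteDimensional k l]
    (π : R →+* k) (hπ : Function.Surjective π)
    (d : ℕ) (hd : (d : WithBot ℕ∞) ≤ ringKrullDim R)
    (hs : ∃ s : Finset R, s.card ≤ d ∧ Ideal.span (s : Set R) = IsLocalRing.maximalIdeal R) :
    ∃ (S : Type u) (_ : CommRing S) (_ : IsDomain S) (_ : IsIntegrallyClosed S) (_ : Algebra R S)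
      (_ : Module.Free R S) (_ : Module.Finite R S) (φ : S →+* l),
      Function.Surjective φ ∧ φ.comp (algebraMap R S) = (algebraMap k l).comp π ∧
      Module.finrank R S = Module.finrank k l := by
  obtain ⟨S, _, _, _, _, _, _, φ, hφ, hcomp, hrk, hdim, hgen⟩ :=
    aux_tower π hπ d hd hs (⊤ : IntermediateField k l)
  obtain ⟨h1, h2⟩ := aux_regular d S hdim hgen
  refine ⟨S, inferInstance, h1, h2, inferInstance, inferInstance, inferInstance,
    (IntermediateField.topEquiv (F := k) (E := l) : _ →+* l).comp φ, ?_, ?_, ?_⟩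
  · rw [RingHom.coe_comp]
    exact (IntermediateField.topEquiv (F := k) (E := l)).surjective.comp hφ
  · rw [RingHom.comp_assoc, hcomp]
    rfl
  · rw [hrk, IntermediateField.finrank_top']

theorem aux_factor {B S L : Type u} [CommRing B] [CommRing S] [CommRing L] (i : S →+* L)
    (hi : Function.Injective i) (g : B →+* L) (h : ∀ b, ∃ s, i s = g b) :
    ∃ σ : B →+* S, ∀ b, i (σ b) = g b := by
  choose σ hσ using h
  exact ⟨{ toFun := σ
           map_one' := hi (by rw [hσ, map_one, map_one])
           map_mul' := fun x y => hi (by rw [hσ, map_mul, map_mul, hσ, hσ])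
           map_zero' := hi (by rw [hσ, map_zero, map_zero])
           map_add' := fun x y => hi (by rw [hσ, map_add, map_add, hσ, hσ]) }, hσ⟩

theorem aux_japanese {A A' : Type u} [CommRing A] [IsDomain A] [CommRing A'] [IsDomain A']
    (e : A' ≃+* A) (h : IsJapanese A') (L : Type u) [Field L] [Algebra A L]
    [Algebra (FractionRing A) L] [IsScalarTower A (FractionRing A) L]
    [FiniteDimensional (FractionRing A) L] : Module.Finite A (integralClosure A L) := by
  letI a1 : Algebra A' L := ((algebraMap A L).comp (e : A' →+* A)).toAlgebra
  let eK : FractionRing A' ≃+* FractionRing A := IsFractionRing.ringEquivOfRingEquiv e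
  letI a2 : Algebra (FractionRing A') L :=
    ((algebraMap (FractionRing A) L).comp (eK : FractionRing A' →+* FractionRing A)).toAlgebra
  haveI : IsScalarTower A' (FractionRing A') L := by
    refine IsScalarTower.of_algebraMap_eq fun x => ?_
    change algebraMap A L (e x) = algebraMap (FractionRing A) L (eK (algebraMap _ _ x))
    rw [IsScalarTower.algebraMap_apply A (FractionRing A) L]
    congr 1
    exact (IsFractionRing.ringEquivOfRingEquiv_algebraMap e x).symm
  haveI : FiniteDimensional (FractionRing A') L :=
    Module.Finite.of_equiv_equiv (A₁ := FractionRing A) (B₁ := L) eK.symm (RingEquiv.refl L) (by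
      ext x
      change algebraMap (FractionRing A) L (eK (eK.symm x)) = algebraMap (FractionRing A) L x
      rw [RingEquiv.apply_symm_apply])
  have hfin := h L
  have hsub : (integralClosure A' L).toSubring = (integralClosure A L).toSubring := by
    ext x
    change IsIntegral A' x ↔ IsIntegral A x
    constructor
    · intro hx
      exact hx.map_of_comp_eq (e : A' →+* A) (RingHom.id L) rfl
    · intro hx
      refine hx.map_of_comp_eq (e.symm : A →+* A') (RingHom.id L) ?_
      ext y
      change algebraMap A L (e (e.symm y)) = algebraMap A L y
      rw [RingEquiv.apply_symm_apply]
  exact Module.Finite.of_equiv_equiv (A₁ := A') (B₁ := integralClosure A' L) e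
    (RingEquiv.subringCongr hsub) (by
      ext x
      rfl)

theorem aux_fracFinrank {A B : Type u} [CommRing A] [IsDomain A] [CommRing B] [IsDomain B]
    [Algebra A B] [Algebra.IsAlgebraic A B] (h : Function.Injective (algebraMap A B)) :
    fracFinrank (algebraMap A B) h = Module.finrank A B := by
  unfold fracFinrank
  letI := ((algebraMap A B).fracMap h).toAlgebra
  haveI : FaithfulSMul A B := (faithfulSMul_iff_algebraMap_injective _ _).2 h
  haveI : IsScalarTower A (FractionRing A) (FractionRing B) := by
    refine IsScalarTower.of_algebraMap_eq fun x => ?_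
    change _ = (algebraMap A B).fracMap h (algebraMap _ _ x)
    rw [RingHom.fracMap, IsFractionRing.lift_algebraMap]
    rfl
  exact IsFractionRing.finrank_eq A (FractionRing A) B (FractionRing B)

theorem aux_isFractionRing {Q C : Type u} [CommRing Q] [CommRing C] [IsDomain C] (ι : Q →+* C)
    (hι : Function.Injective ι)
    (h : ∀ z : FractionRing C, ∃ x y : Q, z = algebraMap C (FractionRing C) (ι x) /
      algebraMap C (FractionRing C) (ι y)) :
    letI := ((algebraMap C (FractionRing C)).comp ι).toAlgebra
    IsFractionRing Q (FractionRing C) := by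
  letI := ((algebraMap C (FractionRing C)).comp ι).toAlgebra
  haveI : FaithfulSMul Q (FractionRing C) :=
    (faithfulSMul_iff_algebraMap_injective _ _).2
      ((IsFractionRing.injective C (FractionRing C)).comp hι)
  exact IsFractionRing.of_field _ _ h

theorem aux_isIntegral {P Q C : Type u} [CommRing P] [CommRing Q] [CommRing C] [Algebra P C]
    [Module.Finite P C] (ι : Q →+* C) (j : P →+* Q) (h : ι.comp j = algebraMap P C) :
    letI := ι.toAlgebra
    Algebra.IsIntegral Q C := by
  letI := ι.toAlgebra
  refine ⟨fun c => ?_⟩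
  have hc : IsIntegral P c := Algebra.IsIntegral.isIntegral c
  exact hc.map_of_comp_eq j (RingHom.id C) h

theorem aux_assemble (A : Type u) [CommRing A] (p : Ideal A) [hp : p.IsPrime] [IsDomain A]
    (C : Type u) [CommRing C] [IsDomain C]
    [Algebra (A ⧸ p) C] (hACinj : Function.Injective (algebraMap (A ⧸ p) C))
    [Module.Finite (A ⧸ p) C] (B : Type u) [CommRing B] [IsDomain B] [Algebra A B]
    (hBic : IsIntegrallyClosed B) (hBfin : Module.Finite A B)
    (hAB : Function.Injective (algebraMap A B)) (τ : B →+* C)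
    (hτA : ∀ a : A, τ (algebraMap A B a) = algebraMap (A ⧸ p) C (Ideal.Quotient.mk p a))
    (hfrac : ∀ z : FractionRing C, ∃ x y : B, z = algebraMap C (FractionRing C) (τ x) /
      algebraMap C (FractionRing C) (τ y))
    (hrank : Module.finrank A B = fracFinrank (algebraMap (A ⧸ p) C) hACinj) :
    ∃ (B : Type u) (instB : CommRing B),
      haveI := instB
      ∃ (instBD : IsDomain B) (instAB : Algebra A B),
        haveI := instBD
        haveI := instAB
        IsIntegrallyClosed B ∧ Module.Finite A B ∧
        ∃ (hABinj : Function.Injective (algebraMap A B))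
          (r : Ideal B) (hr : r.IsPrime) (hover : r.comap (algebraMap A B) = p),
          haveI := hr
          ∃ ι : (B ⧸ r) →+* C,
            Function.Injective ι ∧
            ι.comp (Ideal.quotientMap r (algebraMap A B) hover.ge) = algebraMap (A ⧸ p) C ∧
            (letI := ι.toAlgebra; Algebra.IsIntegral (B ⧸ r) C) ∧
            (letI := ((algebraMap C (FractionRing C)).comp ι).toAlgebra;
              IsFractionRing (B ⧸ r) (FractionRing C)) ∧
            fracFinrank (algebraMap A B) hABinj = fracFinrank (algebraMap (A ⧸ p) C) hACinj := by
  have hover : (RingHom.ker τ).comap (algebraMap A B) = p := by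
    ext a
    rw [Ideal.mem_comap, RingHom.mem_ker, hτA, map_eq_zero_iff _ hACinj,
      Ideal.Quotient.eq_zero_iff_mem]
  have hr : (RingHom.ker τ).IsPrime := RingHom.ker_isPrime τ
  obtain ⟨ι, hι, hιmk⟩ : ∃ ι : (B ⧸ RingHom.ker τ) →+* C, Function.Injective ι ∧
      ∀ b, ι (Ideal.Quotient.mk _ b) = τ b :=
    ⟨RingHom.kerLift τ, RingHom.kerLift_injective τ, fun b => rfl⟩
  have hcomp : ι.comp
      (Ideal.quotientMap (RingHom.ker τ) (algebraMap A B) hover.ge) = algebraMap (A ⧸ p) C := by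
    apply Ideal.Quotient.ringHom_ext
    ext a
    exact (hιmk _).trans (hτA a)
  refine ⟨B, inferInstance, inferInstance, inferInstance, hBic, hBfin, hAB, RingHom.ker τ, hr,
    hover, ι, hι, hcomp, ?_, ?_, ?_⟩
  · exact aux_isIntegral ι _ hcomp
  · refine aux_isFractionRing ι hι fun z => ?_
    obtain ⟨x, y, h⟩ := hfrac z
    exact ⟨Ideal.Quotient.mk _ x, Ideal.Quotient.mk _ y, by rw [hιmk, hιmk, h]⟩
  · rw [aux_fracFinrank, hrank]

theorem aux_global (A : Type u) [CommRing A] [IsDomain A] [IsIntegrallyClosed A]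
    [IsNoetherianRing A] (hNagata : IsNagata A) (p : Ideal A) [hp : p.IsPrime]
    (C : Type u) [CommRing C] [IsDomain C] [IsIntegrallyClosed C]
    [Algebra (A ⧸ p) C] (hACinj : Function.Injective (algebraMap (A ⧸ p) C))
    [Module.Finite (A ⧸ p) C]
    (S : Type u) [CommRing S] [IsDomain S] [IsIntegrallyClosed S]
    [Algebra (Localization.AtPrime p) S] [Module.Free (Localization.AtPrime p) S]
    [Module.Finite (Localization.AtPrime p) S]
    (φ : S →+* FractionRing C) (hφ : Function.Surjective φ)
    (hcompat : ∀ a : A, φ (algebraMap (Localization.AtPrime p) S (algebraMap A _ a)) =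
      algebraMap C (FractionRing C) (algebraMap (A ⧸ p) C (Ideal.Quotient.mk p a)))
    (hrank : Module.finrank (Localization.AtPrime p) S =
      fracFinrank (algebraMap (A ⧸ p) C) hACinj) :
    ∃ (B : Type u) (instB : CommRing B),
      haveI := instB
      ∃ (instBD : IsDomain B) (instAB : Algebra A B),
        haveI := instBD
        haveI := instAB
        IsIntegrallyClosed B ∧ Module.Finite A B ∧
        ∃ (hABinj : Function.Injective (algebraMap A B))
          (r : Ideal B) (hr : r.IsPrime) (hover : r.comap (algebraMap A B) = p),
          haveI := hr
          ∃ ι : (B ⧸ r) →+* C,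
            Function.Injective ι ∧
            ι.comp (Ideal.quotientMap r (algebraMap A B) hover.ge) = algebraMap (A ⧸ p) C ∧
            (letI := ι.toAlgebra; Algebra.IsIntegral (B ⧸ r) C) ∧
            (letI := ((algebraMap C (FractionRing C)).comp ι).toAlgebra;
              IsFractionRing (B ⧸ r) (FractionRing C)) ∧
            fracFinrank (algebraMap A B) hABinj = fracFinrank (algebraMap (A ⧸ p) C) hACinj := by
  let R := Localization.AtPrime p
  let K := FractionRing A
  have hunits : ∀ y : p.primeCompl, IsUnit (algebraMap A K y) := fun y =>
    IsUnit.mk0 _ (by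
      rw [Ne, IsFractionRing.to_map_eq_zero_iff]
      intro h0
      exact y.2 (h0 ▸ p.zero_mem))
  letI algRK : Algebra R K := (IsLocalization.lift (M := p.primeCompl) hunits).toAlgebra
  haveI tARK : IsScalarTower A R K := IsScalarTower.of_algebraMap_eq fun x =>
    (IsLocalization.lift_eq (M := p.primeCompl) hunits x).symm
  haveI : IsFractionRing R K :=
    IsFractionRing.isFractionRing_of_isDomain_of_isLocalization p.primeCompl R K
  letI algAS : Algebra A S := ((algebraMap R S).comp (algebraMap A R)).toAlgebra
  haveI tARS : IsScalarTower A R S := IsScalarTower.of_algebraMap_eq fun x => rfl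
  let L := FractionRing S
  have hRS : Function.Injective (algebraMap R S) := FaithfulSMul.algebraMap_injective R S
  have hRL : Function.Injective (algebraMap R L) := by
    rw [IsScalarTower.algebraMap_eq R S L]
    exact (IsFractionRing.injective S L).comp hRS
  letI algKL : Algebra K L := (IsFractionRing.lift (A := R) (K := K) hRL).toAlgebra
  haveI tRKL : IsScalarTower R K L := IsScalarTower.of_algebraMap_eq fun x =>
    (IsFractionRing.lift_algebraMap (A := R) (K := K) hRL x).symm
  haveI tAKL : IsScalarTower A K L := IsScalarTower.of_algebraMap_eq fun x => by
    rw [IsScalarTower.algebraMap_apply A R K, ← IsScalarTower.algebraMap_apply R K L,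
      IsScalarTower.algebraMap_apply A S L, IsScalarTower.algebraMap_apply R S L,
      IsScalarTower.algebraMap_apply A R S]
  have hKL : Module.finrank K L = Module.finrank R S := IsFractionRing.finrank_eq R K S L
  haveI : FiniteDimensional K L := by
    apply Module.finite_of_finrank_pos
    rw [hKL]
    exact Module.finrank_pos
  have hAL : Function.Injective (algebraMap A L) := by
    rw [IsScalarTower.algebraMap_eq A K L]
    exact (algebraMap K L).injective.comp (IsFractionRing.injective A K)
  let B := integralClosure A L
  have hBfin : Module.Finite A B :=
    aux_japanese (RingEquiv.quotientBot A)
      (hNagata.2 ⊥ Ideal.isPrime_bot) L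
  have hBL : IsFractionRing B L := integralClosure.isFractionRing_of_finite_extension K L
  have hBic : IsIntegrallyClosed B := integralClosure.isIntegrallyClosedOfFiniteExtension K
  have hAB : Function.Injective (algebraMap A B) := by
    intro x y hxy
    apply hAL
    rw [IsScalarTower.algebraMap_apply A B L, hxy, ← IsScalarTower.algebraMap_apply A B L]
  haveI : FaithfulSMul A B := (faithfulSMul_iff_algebraMap_injective _ _).2 hAB
  have hKB : Module.finrank K L = Module.finrank A B := IsFractionRing.finrank_eq A K B L
  obtain ⟨σ, hσ⟩ := aux_factor (algebraMap S L) (IsFractionRing.injective S L)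
    (algebraMap B L) (fun b => IsIntegrallyClosed.algebraMap_eq_of_integral
      (IsIntegral.tower_top (R := A) b.2))
  have hσA : ∀ a : A, σ (algebraMap A B a) = algebraMap R S (algebraMap A R a) := by
    intro a
    apply IsFractionRing.injective S L
    rw [hσ, ← IsScalarTower.algebraMap_apply A B L, IsScalarTower.algebraMap_apply A S L]
    rfl
  obtain ⟨τ, hτ⟩ := aux_factor (algebraMap C (FractionRing C))
    (IsFractionRing.injective C (FractionRing C)) (φ.comp σ) (fun b => by
      have hb : IsIntegral A b := Algebra.IsIntegral.isIntegral b
      refine IsIntegrallyClosed.algebraMap_eq_of_integral (hb.map_of_comp_eq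
        ((algebraMap (A ⧸ p) C).comp (Ideal.Quotient.mk p)) (φ.comp σ) ?_)
      ext a
      simp only [RingHom.comp_apply]
      rw [hσA, hcompat])
  have hτA : ∀ a : A, τ (algebraMap A B a) = algebraMap (A ⧸ p) C (Ideal.Quotient.mk p a) := by
    intro a
    apply IsFractionRing.injective C (FractionRing C)
    rw [hτ, RingHom.comp_apply, hσA, hcompat]
  refine aux_assemble A p C hACinj B hBic hBfin hAB τ hτA ?_ ?_
  · intro z
    obtain ⟨e, rfl⟩ := hφ z
    have he : IsIntegral R e := Algebra.IsIntegral.isIntegral e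
    obtain ⟨s, hs⟩ := he.exists_multiple_integral_of_isLocalization p.primeCompl e
    have hs' : IsIntegral A (algebraMap S L ((s : A) • e)) := hs.algebraMap
    let b : B := ⟨algebraMap S L ((s : A) • e), hs'⟩
    have hb : σ b = (s : A) • e := IsFractionRing.injective S L (hσ b)
    refine ⟨b, algebraMap A B s, ?_⟩
    have hne : algebraMap C (FractionRing C) (τ (algebraMap A B s)) ≠ 0 := by
      rw [hτA, Ne, IsFractionRing.to_map_eq_zero_iff, map_eq_zero_iff _ hACinj,
        Ideal.Quotient.eq_zero_iff_mem]
      exact s.2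
    rw [eq_div_iff hne, hτ, hτ, RingHom.comp_apply, RingHom.comp_apply, hb, hσA, ← map_mul,
      Algebra.smul_def, mul_comm]
    rfl
  · rw [← hKB, hKL, hrank]

theorem exists_finite_extension_of_integral_closure
    (A : Type u) [CommRing A] [IsDomain A] [IsIntegrallyClosed A] [IsNoetherianRing A]
    (hNagata : IsNagata A)
    (p : Ideal A) [hp : p.IsPrime]
    (C : Type u) [CommRing C] [IsDomain C] [IsIntegrallyClosed C]
    [Algebra (A ⧸ p) C] (hACinj : Function.Injective (algebraMap (A ⧸ p) C))
    [Module.Finite (A ⧸ p) C]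
    (hcond : PerfectField (FractionRing (A ⧸ p)) ∨ IsRegularLocal (Localization.AtPrime p)) :
    ∃ (B : Type u) (instB : CommRing B),
      haveI := instB
      ∃ (instBD : IsDomain B) (instAB : Algebra A B),
        haveI := instBD
        haveI := instAB
        IsIntegrallyClosed B ∧ Module.Finite A B ∧
        ∃ (hABinj : Function.Injective (algebraMap A B))
          (r : Ideal B) (hr : r.IsPrime) (hover : r.comap (algebraMap A B) = p),
          haveI := hr
          ∃ ι : (B ⧸ r) →+* C,
            Function.Injective ι ∧
            ι.comp (Ideal.quotientMap r (algebraMap A B) hover.ge) = algebraMap (A ⧸ p) C ∧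
            (letI := ι.toAlgebra; Algebra.IsIntegral (B ⧸ r) C) ∧
            (letI := ((algebraMap C (FractionRing C)).comp ι).toAlgebra;
              IsFractionRing (B ⧸ r) (FractionRing C)) ∧
            fracFinrank (algebraMap A B) hABinj = fracFinrank (algebraMap (A ⧸ p) C) hACinj := by
  classical
  let R := Localization.AtPrime p
  let k := FractionRing (A ⧸ p)
  let g : A →+* k := (algebraMap (A ⧸ p) k).comp (Ideal.Quotient.mk p)
  have hg : ∀ y : p.primeCompl, IsUnit (g y) := fun y => IsUnit.mk0 _ (by
    change algebraMap (A ⧸ p) k (Ideal.Quotient.mk p y) ≠ 0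
    rw [Ne, IsFractionRing.to_map_eq_zero_iff, Ideal.Quotient.eq_zero_iff_mem]
    exact y.2)
  let π : R →+* k := IsLocalization.lift (M := p.primeCompl) hg
  have hπA : ∀ a : A, π (algebraMap A R a) = g a := fun a => IsLocalization.lift_eq hg a
  have hπ : Function.Surjective π := by
    intro z
    obtain ⟨a, b, hb, rfl⟩ := IsFractionRing.div_surjective (A := A ⧸ p) z
    obtain ⟨a, rfl⟩ := Ideal.Quotient.mk_surjective a
    obtain ⟨b, rfl⟩ := Ideal.Quotient.mk_surjective b
    have hb' : b ∈ p.primeCompl := fun hbp =>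
      nonZeroDivisors.ne_zero hb (Ideal.Quotient.eq_zero_iff_mem.2 hbp)
    refine ⟨IsLocalization.mk' R a ⟨b, hb'⟩, ?_⟩
    have hgb : g b ≠ 0 := (hg ⟨b, hb'⟩).ne_zero
    change π _ = g a / g b
    rw [eq_div_iff hgb, ← hπA, ← hπA, ← map_mul]
    congr 1
    exact IsLocalization.mk'_spec R a ⟨b, hb'⟩
  letI algkl : Algebra k (FractionRing C) := ((algebraMap (A ⧸ p) C).fracMap hACinj).toAlgebra
  have hkl : ∀ x : A ⧸ p, algebraMap k (FractionRing C) (algebraMap (A ⧸ p) k x) =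
      algebraMap C (FractionRing C) (algebraMap (A ⧸ p) C x) := by
    intro x
    change (algebraMap (A ⧸ p) C).fracMap hACinj (algebraMap _ _ x) = _
    rw [RingHom.fracMap, IsFractionRing.lift_algebraMap]
    rfl
  haveI : FiniteDimensional k (FractionRing C) := by
    haveI : FaithfulSMul (A ⧸ p) C := (faithfulSMul_iff_algebraMap_injective _ _).2 hACinj
    haveI : IsScalarTower (A ⧸ p) k (FractionRing C) :=
      IsScalarTower.of_algebraMap_eq fun x => (hkl x).symm
    apply Module.finite_of_finrank_pos
    have h1 : Module.finrank k (FractionRing C) = Module.finrank (A ⧸ p) C :=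
      IsFractionRing.finrank_eq (A ⧸ p) k C (FractionRing C)
    rw [h1]
    exact Module.finrank_pos
  have key : ∃ (S : Type u) (_ : CommRing S) (_ : IsDomain S) (_ : IsIntegrallyClosed S)
      (_ : Algebra R S) (_ : Module.Free R S) (_ : Module.Finite R S)
      (φ : S →+* FractionRing C), Function.Surjective φ ∧
      φ.comp (algebraMap R S) = (algebraMap k (FractionRing C)).comp π ∧
      Module.finrank R S = Module.finrank k (FractionRing C) := by
    rcases hcond with hperf | ⟨hN, hloc, hdim⟩
    · haveI : PerfectField k := hperf
      haveI : IsIntegrallyClosed R :=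
        isIntegrallyClosed_of_isLocalization _ p.primeCompl p.primeCompl_le_nonZeroDivisors
      exact aux_case1 π hπ
    · haveI : IsNoetherianRing R := hN
      have hne : {n : ℕ | ∃ s : Finset R, s.card = n ∧
          Ideal.span (s : Set R) = IsLocalRing.maximalIdeal R}.Nonempty := by
        obtain ⟨s, hs⟩ := IsNoetherian.noetherian (IsLocalRing.maximalIdeal R)
        exact ⟨_, s, rfl, hs⟩
      obtain ⟨s, hsc, hsm⟩ := Nat.sInf_mem hne
      exact aux_case2 π hπ _ hdim.le ⟨s, hsc.le, hsm⟩
  obtain ⟨S, _, _, _, _, _, _, φ, hφ, hcomp, hrank⟩ := key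
  refine aux_global A hNagata p C hACinj S φ hφ (fun a => ?_) hrank
  have := RingHom.congr_fun hcomp (algebraMap A R a)
  simp only [RingHom.comp_apply] at this
  rw [this, hπA]
  exact hkl _

end
end
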